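/- arXiv:2206.08166 — 4 statements merged into one kernel-verified Lean document; each statement's English description precedes it below -/
import Mathlib

section
/- Let V be a finite-dimensional complex vector space with endomorphisms H, X, Y satisfying [H,X] = 2X, [H,Y] = −2Y, [X,Y] = H, let Q be a nondegenerate hermitian pairing on V with H† = −H, X† = X, Y† = Y, and let F be an sl₂-Hodge filtration of weight n on V. Let V^{sl₂} = {v ∈ V : Hv = 0 and Yv = 0} be the subspace of sl₂-invariants. Then V^{sl₂} is a sub-Hodge structure of the polarized weight-n Hodge structure V = ⊕_{p+q=n} V^{p,q} determined by e^Y F and Q (i.e., for every v ∈ V^{sl₂}, each Hodge component v^{p,q} lies in V^{sl₂}); the resulting decomposition V^{sl₂} = ⊕_{p+q=n} (V^{p,q} ∩ V^{sl₂}) is a Hodge structure of weight n polarized by the restriction of Q, and its Hodge filtration equals F ∩ V^{sl₂} (which coincides with e^Y F ∩ V^{sl₂} since Y acts trivially on V^{sl₂}). -/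
/-!
For an sl₂-Hodge filtration `F` of weight `n` on `(V, H, X, Y, Q)`, the subspace of
sl₂-invariants `V^{sl₂} = ker H ∩ ker Y` is a sub-Hodge structure of the polarized
weight-`n` Hodge structure determined by `e^Y F` and `Q`; the induced decomposition
of `V^{sl₂}` is a weight-`n` Hodge structure polarized by the restriction of `Q`, with
Hodge filtration `F ∩ V^{sl₂}` (which coincides with `e^Y F ∩ V^{sl₂}`).
-/

/-- `c : ℂ` is a positive real number. -/
def posC (c : ℂ) : Prop := c.im = 0 ∧ 0 < c.re

/-- The exponential of a nilpotent endomorphism of a finite-dimensional space. -/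
noncomputable def expEnd {V : Type*} [AddCommGroup V] [Module ℂ V] [FiniteDimensional ℂ V]
    (A : V →ₗ[ℂ] V) : V →ₗ[ℂ] V :=
  ∑ k ∈ Finset.range (Module.finrank ℂ V + 1), ((k.factorial : ℂ))⁻¹ • A ^ k

/-- The `Q`-annihilator `{v : V | Q(v, x) = 0 for all x ∈ U}` of a subspace `U`. -/
def annQ {V : Type*} [AddCommGroup V] [Module ℂ V]
    (Q : V →ₗ[ℂ] V →ₛₗ[starRingEnd ℂ] ℂ) (U : Submodule ℂ V) : Submodule ℂ V where
  carrier := {v | ∀ x ∈ U, Q v x = 0}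
  add_mem' {a b} ha hb := by
    intro x hx
    have h : Q (a + b) x = Q a x + Q b x := by simp
    rw [h, ha x hx, hb x hx, add_zero]
  zero_mem' := by intro x hx; simp
  smul_mem' c a ha := by
    intro x hx
    have h : Q (c • a) x = c * Q a x := by simp
    rw [h, ha x hx, mul_zero]

/-- The Hodge piece `V^{p, n−p} = (e^Y F)^p ∩ F̄^{n−p}` of the Hodge structure
determined by `e^Y F` and `Q`, where `F̄^{n−p}` is the `Q`-annihilator of
`(e^Y F)^{p+1}`. -/
noncomputable def hodgePiece {V : Type*} [AddCommGroup V] [Module ℂ V]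
    [FiniteDimensional ℂ V] (Y : V →ₗ[ℂ] V) (F : ℤ → Submodule ℂ V)
    (Q : V →ₗ[ℂ] V →ₛₗ[starRingEnd ℂ] ℂ) (p : ℤ) : Submodule ℂ V :=
  Submodule.map (expEnd Y) (F p) ⊓ annQ Q (Submodule.map (expEnd Y) (F (p + 1)))

namespace SlTwoHodge

variable {V : Type*} [AddCommGroup V] [Module ℂ V]

/-- If `[H, Y] = -2 Y`, then `[H, Y ^ k] = -2 k Y ^ k`. -/
lemma mul_pow_sub_pow_mul {H Y : Module.End ℂ V} (h : H * Y - Y * H = (-2 : ℂ) • Y) (k : ℕ) :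
    H * Y ^ k - Y ^ k * H = (-2 * k : ℂ) • Y ^ k := by
  induction k with
  | zero => simp
  | succ k ih =>
    have h1 : H * Y ^ (k + 1) - Y ^ (k + 1) * H =
        (H * Y ^ k - Y ^ k * H) * Y + Y ^ k * (H * Y - Y * H) := by
      rw [pow_succ]; noncomm_ring
    rw [h1, ih, h, smul_mul_assoc, mul_smul_comm, ← pow_succ, ← add_smul]
    push_cast
    ring_nf

/-- The core estimate: `u` is the top Hodge component of the invariant vector `u + w`. -/
lemma top_component_mem {H Y : Module.End ℂ V} {n : ℤ}
    {Q : V →ₗ[ℂ] V →ₛₗ[starRingEnd ℂ] ℂ}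
    (hHY : H * Y - Y * H = (-2 : ℂ) • Y)
    (hQH : ∀ v w : V, Q (H v) w = -Q v (H w))
    (hQY : ∀ v w : V, Q (Y v) w = Q v (Y w))
    {G : ℤ → Submodule ℂ V} (hG : Antitone G)
    (hYG : ∀ p, ∀ x ∈ G p, Y x ∈ G (p - 1))
    (hKG : ∀ p, ∀ x ∈ G p, H x + (2 : ℂ) • Y x ∈ G p)
    (horth : ∀ p p' : ℤ, p ≠ p' → ∀ v ∈ G p ⊓ annQ Q (G (p + 1)),
      ∀ w ∈ G p' ⊓ annQ Q (G (p' + 1)), Q v w = 0)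
    (hpos : ∀ p : ℤ, ∀ v ∈ G p ⊓ annQ Q (G (p + 1)), v ≠ 0 →
      posC ((-1 : ℂ) ^ (n - p) * Q v v))
    {p : ℤ} {u w : V} (hu : u ∈ G p ⊓ annQ Q (G (p + 1))) (hw : w ∈ annQ Q (G p))
    (hinv : u + w ∈ LinearMap.ker H ⊓ LinearMap.ker Y) :
    u ∈ LinearMap.ker H ⊓ LinearMap.ker Y := by
  obtain ⟨huG, huA⟩ := hu
  have hH : H u = -H w := by
    have h : H (u + w) = 0 := hinv.1
    rw [map_add] at h
    exact eq_neg_of_add_eq_zero_left h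
  have hY : Y u = -Y w := by
    have h : Y (u + w) = 0 := hinv.2
    rw [map_add] at h
    exact eq_neg_of_add_eq_zero_left h
  -- `2Y - H` is adjoint to `H + 2Y`, hence preserves the annihilators.
  have hK' : ∀ q, ∀ x ∈ annQ Q (G q), (2 : ℂ) • Y x - H x ∈ annQ Q (G q) := by
    intro q x hx y hy
    have h := hx _ (hKG q y hy)
    simp only [map_add, map_sub, map_smul, LinearMap.sub_apply, LinearMap.smul_apply,
      LinearMap.map_smulₛₗ, smul_eq_mul, map_ofNat, hQH, hQY] at h ⊢
    linear_combination h
  have hYA : Y w ∈ annQ Q (G (p + 1)) := by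
    intro y hy
    rw [hQY]
    have h := hYG _ y hy
    rw [add_sub_cancel_right] at h
    exact hw _ h
  have hmono : annQ Q (G p) ≤ annQ Q (G (p + 1)) :=
    fun x hx y hy => hx y (hG (by omega) hy)
  set k := H u + (2 : ℂ) • Y u with hk
  set k' := (2 : ℂ) • Y u - H u with hk'
  have hkP : k ∈ G p ⊓ annQ Q (G (p + 1)) := by
    refine ⟨hKG p u huG, ?_⟩
    have h : k = ((2 : ℂ) • Y w - H w) - (4 : ℂ) • Y w := by
      rw [hk, hH, hY]; module
    rw [h]
    exact Submodule.sub_mem _ (hmono (hK' p w hw)) (Submodule.smul_mem _ _ hYA)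
  have hkP' : k' ∈ G (p - 1) ⊓ annQ Q (G (p - 1 + 1)) := by
    constructor
    · have h : k' = (4 : ℂ) • Y u - k := by rw [hk, hk']; module
      rw [h]
      exact Submodule.sub_mem _ (Submodule.smul_mem _ _ (hYG p u huG))
        (hG (by omega) hkP.1)
    · rw [sub_add_cancel]
      have h : k' = -((2 : ℂ) • Y w - H w) := by rw [hk', hH, hY]; module
      rw [h]
      exact Submodule.neg_mem _ (hK' p w hw)
  have hYu : Y u = (1 / 4 : ℂ) • (k + k') := by rw [hk, hk']; module
  have hHu : H u = (1 / 2 : ℂ) • (k - k') := by rw [hk, hk']; module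
  have hkk' : Q k k' = 0 := horth _ _ (by omega) k hkP k' hkP'
  have hk'k : Q k' k = 0 := horth _ _ (by omega) k' hkP' k hkP
  have hk'u : Q k' u = 0 := horth _ _ (by omega) k' hkP' u ⟨huG, huA⟩
  have huk' : Q u k' = 0 := horth _ _ (by omega) u ⟨huG, huA⟩ k' hkP'
  have e1 : Q k u = Q u k := by
    have h := hQY u u
    rw [hYu] at h
    simp only [map_add, map_smul, LinearMap.add_apply, LinearMap.smul_apply,
      LinearMap.map_smulₛₗ, smul_eq_mul, map_div₀, map_one, map_ofNat] at h
    linear_combination 4 * h - hk'u + huk'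
  have e2 : Q k u = -Q u k := by
    have h := hQH u u
    rw [hHu] at h
    simp only [map_sub, map_smul, LinearMap.sub_apply, LinearMap.smul_apply,
      LinearMap.map_smulₛₗ, smul_eq_mul, map_div₀, map_one, map_ofNat] at h
    linear_combination 2 * h + hk'u + huk'
  have e3 : Q k u = 0 := by linear_combination (e1 + e2) / 2
  have e4 : Q k k = Q k' k' := by
    have h := congrArg (fun A : Module.End ℂ V => Q (A u) u) hHY
    simp only [LinearMap.sub_apply, Module.End.mul_apply, LinearMap.smul_apply, map_sub,
      map_smul, smul_eq_mul] at h
    rw [hQH, hQY (H u), hYu, hHu] at h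
    simp only [map_add, map_sub, map_smul, LinearMap.add_apply, LinearMap.sub_apply,
      LinearMap.smul_apply, LinearMap.map_smulₛₗ, smul_eq_mul, map_div₀, map_one,
      map_ofNat] at h
    linear_combination -4 * h + 2 * e3 + 2 * hk'u
  have hsign : (-1 : ℂ) ^ (n - (p - 1)) = -(-1 : ℂ) ^ (n - p) := by
    rw [show n - (p - 1) = (n - p) + 1 by ring, zpow_add_one₀ (by norm_num)]
    ring
  have hzero : k = 0 ∧ k' = 0 := by
    by_cases h0 : k = 0
    · refine ⟨h0, ?_⟩
      by_contra h1
      have h2 := (hpos _ k' hkP' h1).2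
      rw [← e4, h0] at h2
      simp at h2
    · exfalso
      have h1 := (hpos _ k hkP h0).2
      have h2 : k' ≠ 0 := by
        intro h2
        rw [e4, h2] at h1
        simp at h1
      have h3 := (hpos _ k' hkP' h2).2
      rw [hsign, ← e4, neg_mul, Complex.neg_re] at h3
      linarith
  rw [Submodule.mem_inf, LinearMap.mem_ker, LinearMap.mem_ker, hHu, hYu, hzero.1, hzero.2]
  simp

/-- If each top component of an invariant vector is invariant, then all of its components are. -/
lemma components_mem {P A : ℤ → Submodule ℂ V} {I : Submodule ℂ V}
    (hPA : ∀ i j, i < j → P i ≤ A j)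
    (htop : ∀ p, ∀ u ∈ P p, ∀ w ∈ A p, u + w ∈ I → u ∈ I)
    (t : Finset ℤ) {s : ℤ → V} (hs : ∀ p, s p ∈ P p) (hsum : ∑ p ∈ t, s p ∈ I) :
    ∀ p ∈ t, s p ∈ I := by
  induction t using Finset.induction_on_max with
  | empty => simp
  | insert a t ha ih =>
    have hat : a ∉ t := fun h => lt_irrefl _ (ha a h)
    rw [Finset.sum_insert hat] at hsum
    have h1 : s a ∈ I := htop a (s a) (hs a) _
      (Submodule.sum_mem _ fun i hi => hPA i a (ha i hi) (hs i)) hsum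
    have h2 := ih ((Submodule.add_mem_iff_right _ h1).1 hsum)
    intro p hp
    rcases Finset.mem_insert.1 hp with rfl | hp
    · exact h1
    · exact h2 p hp

variable [FiniteDimensional ℂ V]

/-- If `[H, Y] = -2 Y`, then `Y` is nilpotent. -/
lemma isNilpotent_of_commutator {H Y : Module.End ℂ V}
    (h : H * Y - Y * H = (-2 : ℂ) • Y) : IsNilpotent Y := by
  by_contra hn
  have hne : ∀ k : ℕ, Y ^ k ≠ 0 := fun k hk => hn ⟨k, hk⟩
  let adH : Module.End ℂ (Module.End ℂ V) := LinearMap.mulLeft ℂ H - LinearMap.mulRight ℂ H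
  have hli := Module.End.eigenvectors_linearIndependent' adH (fun k : ℕ => (-2 * k : ℂ))
    (fun a b hab => by simpa using hab) (fun k => Y ^ k)
    (fun k => Module.End.hasEigenvector_iff.2
      ⟨Module.End.mem_eigenspace_iff.2 (by simpa [adH] using mul_pow_sub_pow_mul h k), hne k⟩)
  exact not_finite_iff_infinite.2 inferInstance hli.finite

/-- An endomorphism commutes with its exponential. -/
lemma commute_expEnd (Y : Module.End ℂ V) : Commute Y (expEnd Y : Module.End ℂ V) := by
  unfold expEnd
  exact Commute.sum_right _ _ _ fun k _ => ((Commute.refl Y).pow_right k).smul_right _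

lemma pow_finrank_eq_zero {Y : Module.End ℂ V} (hY : IsNilpotent Y) :
    Y ^ Module.finrank ℂ V = 0 := by
  have h := (LinearMap.isNilpotent_iff_charpoly Y).1 hY
  simpa [h] using LinearMap.aeval_self_charpoly Y

/-- `H e^Y - e^Y H = -2 Y e^Y` whenever `[H, Y] = -2 Y`. -/
lemma mul_expEnd_sub {H Y : Module.End ℂ V} (h : H * Y - Y * H = (-2 : ℂ) • Y) :
    H * (expEnd Y : Module.End ℂ V) - (expEnd Y : Module.End ℂ V) * H =
      (-2 : ℂ) • (Y * (expEnd Y : Module.End ℂ V)) := by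
  have hd := pow_finrank_eq_zero (isNilpotent_of_commutator h)
  have h1 : H * (expEnd Y : Module.End ℂ V) - (expEnd Y : Module.End ℂ V) * H =
      ∑ k ∈ Finset.range (Module.finrank ℂ V + 1),
        ((k.factorial : ℂ))⁻¹ • ((-2 * k : ℂ) • Y ^ k) := by
    simp only [expEnd, Finset.mul_sum, Finset.sum_mul, ← Finset.sum_sub_distrib,
      mul_smul_comm, smul_mul_assoc, ← smul_sub, mul_pow_sub_pow_mul h]
  have h2 : Y * (expEnd Y : Module.End ℂ V) =
      ∑ k ∈ Finset.range (Module.finrank ℂ V + 1), ((k.factorial : ℂ))⁻¹ • Y ^ (k + 1) := by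
    simp only [expEnd, Finset.mul_sum, mul_smul_comm, ← pow_succ']
  rw [h1, h2, Finset.sum_range_succ', Finset.sum_range_succ, pow_succ, hd]
  simp only [CharP.cast_eq_zero, mul_zero, zero_smul, smul_zero, add_zero, zero_mul,
    Finset.smul_sum]
  refine Finset.sum_congr rfl fun k _ => ?_
  rw [smul_smul, smul_smul]
  congr 1
  have : (k.factorial : ℂ) ≠ 0 := by exact_mod_cast k.factorial_ne_zero
  have : (k + 1 : ℂ) ≠ 0 := by exact_mod_cast k.succ_ne_zero
  push_cast [Nat.factorial_succ]
  field_simp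

/-- The exponential of an endomorphism fixes its kernel pointwise. -/
lemma expEnd_apply_of_mem_ker {Y : Module.End ℂ V} {v : V} (hv : Y v = 0) :
    expEnd Y v = v := by
  rw [expEnd, Finset.sum_range_succ', LinearMap.add_apply, LinearMap.sum_apply,
    Finset.sum_eq_zero]
  · simp
  · intro k _
    simp [pow_succ, hv]

lemma isUnit_expEnd {Y : Module.End ℂ V} (hY : IsNilpotent Y) :
    IsUnit (expEnd Y : Module.End ℂ V) := by
  have h1 : (expEnd Y : Module.End ℂ V) = (∑ k ∈ Finset.range (Module.finrank ℂ V),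
      (((k + 1).factorial : ℂ))⁻¹ • Y ^ k) * Y + 1 := by
    simp [expEnd, Finset.sum_range_succ', Finset.sum_mul, pow_succ]
  rw [h1]
  refine IsNilpotent.isUnit_add_one (Commute.isNilpotent_mul_left ?_ hY)
  exact (Commute.sum_right _ _ _ fun k _ =>
    ((Commute.refl Y).pow_right k).smul_right _).symm

/-- If `e^Y f` lies in the kernel of the nilpotent `Y`, then `e^Y f = f`. -/
lemma expEnd_apply_eq_self {Y : Module.End ℂ V} (hY : IsNilpotent Y) {f : V}
    (hf : Y (expEnd Y f) = 0) : expEnd Y f = f := by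
  apply expEnd_apply_of_mem_ker
  have h1 : expEnd Y (Y f) = 0 := by
    rw [← hf]
    exact (LinearMap.congr_fun (commute_expEnd Y).eq f).symm
  exact ((Module.End.isUnit_iff _).1 (isUnit_expEnd hY)).injective (by rw [h1, map_zero])

end SlTwoHodge

theorem sl2_invariants_sub_hodge_structure
    {V : Type*} [AddCommGroup V] [Module ℂ V] [FiniteDimensional ℂ V]
    (n : ℤ) (H X Y : V →ₗ[ℂ] V)
    -- the sl₂-relations
    (hHX : H ∘ₗ X - X ∘ₗ H = (2 : ℂ) • X)
    (hHY : H ∘ₗ Y - Y ∘ₗ H = (-2 : ℂ) • Y)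
    (hXY : X ∘ₗ Y - Y ∘ₗ X = H)
    -- the nondegenerate hermitian pairing `Q` with `H† = −H`, `X† = X`, `Y† = Y`
    (Q : V →ₗ[ℂ] V →ₛₗ[starRingEnd ℂ] ℂ)
    (hherm : ∀ v w : V, Q w v = starRingEnd ℂ (Q v w))
    (hnd : ∀ v : V, (∀ w : V, Q v w = 0) → v = 0)
    (hQH : ∀ v w : V, Q (H v) w = -Q v (H w))
    (hQX : ∀ v w : V, Q (X v) w = Q v (X w))
    (hQY : ∀ v w : V, Q (Y v) w = Q v (Y w))
    -- the sl₂-Hodge filtration `F` of weight `n`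
    (F : ℤ → Submodule ℂ V) (hFanti : Antitone F)
    (hYF : ∀ p : ℤ, Submodule.map Y (F p) ≤ F (p - 1))
    (hHF : ∀ p : ℤ, Submodule.map H (F p) = F p)
    -- `e^Y F` is the Hodge filtration of a weight-`n` Hodge structure polarized by `Q`
    (hInt : DirectSum.IsInternal (fun p : ℤ => hodgePiece Y F Q p))
    (horth : ∀ p p' : ℤ, p ≠ p' →
      ∀ v ∈ hodgePiece Y F Q p, ∀ w ∈ hodgePiece Y F Q p', Q v w = 0)
    (hpos : ∀ p : ℤ, ∀ v ∈ hodgePiece Y F Q p, v ≠ 0 →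
      posC ((-1 : ℂ) ^ (n - p) * Q v v)) :
    -- `V^{sl₂} = ker H ∩ ker Y` is a sub-Hodge structure:
    -- each Hodge component of `v ∈ V^{sl₂}` lies in `V^{sl₂}`,
    (∀ v ∈ LinearMap.ker H ⊓ LinearMap.ker Y, ∀ s : ℤ →₀ V,
      (∀ p : ℤ, s p ∈ hodgePiece Y F Q p) → v = s.sum (fun _ x => x) →
      ∀ p : ℤ, s p ∈ LinearMap.ker H ⊓ LinearMap.ker Y) ∧
    -- the induced decomposition of `V^{sl₂}` spans it,
    ((⨆ p : ℤ, hodgePiece Y F Q p ⊓ (LinearMap.ker H ⊓ LinearMap.ker Y)) =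
      LinearMap.ker H ⊓ LinearMap.ker Y) ∧
    -- it is polarized by the restriction of `Q`:
    (∀ p p' : ℤ, p ≠ p' →
      ∀ v ∈ hodgePiece Y F Q p ⊓ (LinearMap.ker H ⊓ LinearMap.ker Y),
      ∀ w ∈ hodgePiece Y F Q p' ⊓ (LinearMap.ker H ⊓ LinearMap.ker Y), Q v w = 0) ∧
    (∀ p : ℤ, ∀ v ∈ hodgePiece Y F Q p ⊓ (LinearMap.ker H ⊓ LinearMap.ker Y), v ≠ 0 →
      posC ((-1 : ℂ) ^ (n - p) * Q v v)) ∧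
    -- its Hodge filtration is `F ∩ V^{sl₂}`,
    (∀ p : ℤ, (⨆ i : ℤ, ⨆ (_ : p ≤ i),
        hodgePiece Y F Q i ⊓ (LinearMap.ker H ⊓ LinearMap.ker Y)) =
      F p ⊓ (LinearMap.ker H ⊓ LinearMap.ker Y)) ∧
    -- which coincides with `e^Y F ∩ V^{sl₂}` since `Y` acts trivially on `V^{sl₂}`.
    (∀ p : ℤ, Submodule.map (expEnd Y) (F p) ⊓ (LinearMap.ker H ⊓ LinearMap.ker Y) =
      F p ⊓ (LinearMap.ker H ⊓ LinearMap.ker Y)) := by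
  have hHY' : (H : Module.End ℂ V) * Y - Y * H = (-2 : ℂ) • Y := hHY
  have hnil := SlTwoHodge.isNilpotent_of_commutator hHY'
  have hG : Antitone fun p => Submodule.map (expEnd Y) (F p) :=
    fun p q hpq => Submodule.map_mono (hFanti hpq)
  have hYG : ∀ p, ∀ x ∈ Submodule.map (expEnd Y) (F p),
      Y x ∈ Submodule.map (expEnd Y) (F (p - 1)) := by
    rintro p _ ⟨f, hf, rfl⟩
    exact ⟨Y f, hYF p ⟨f, hf, rfl⟩,
      (LinearMap.congr_fun (SlTwoHodge.commute_expEnd Y).eq f).symm⟩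
  have hKG : ∀ p, ∀ x ∈ Submodule.map (expEnd Y) (F p),
      H x + (2 : ℂ) • Y x ∈ Submodule.map (expEnd Y) (F p) := by
    rintro p _ ⟨f, hf, rfl⟩
    refine ⟨H f, (hHF p).le ⟨f, hf, rfl⟩, ?_⟩
    have h : H (expEnd Y f) - expEnd Y (H f) = (-2 : ℂ) • Y (expEnd Y f) :=
      LinearMap.congr_fun (SlTwoHodge.mul_expEnd_sub hHY') f
    rw [eq_add_of_sub_eq h]
    module
  have hcomp : ∀ v ∈ LinearMap.ker H ⊓ LinearMap.ker Y, ∀ s : ℤ →₀ V,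
      (∀ p : ℤ, s p ∈ hodgePiece Y F Q p) → v = s.sum (fun _ x => x) →
      ∀ p : ℤ, s p ∈ LinearMap.ker H ⊓ LinearMap.ker Y := by
    intro v hv s hs hvs p
    by_cases hp : p ∈ s.support
    · refine SlTwoHodge.components_mem
        (A := fun p => annQ Q (Submodule.map (expEnd Y) (F p))) ?_ ?_ s.support hs
        (by rw [hvs] at hv; exact hv) p hp
      · exact fun i j hij x hx y hy => hx.2 y (hG (Int.add_one_le_iff.2 hij) hy)
      · exact fun q u hu w hw hi => SlTwoHodge.top_component_mem hHY' hQH hQY hG hYG hKG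
          horth hpos hu hw hi
    · rw [Finsupp.notMem_support_iff.1 hp]
      exact Submodule.zero_mem _
  have hdec : ∀ v : V, ∃ s : ℤ →₀ V, (∀ p, s p ∈ hodgePiece Y F Q p) ∧
      s.sum (fun _ x => x) = v := by
    intro v
    refine (Submodule.mem_iSup_iff_exists_finsupp _ v).1 ?_
    rw [hInt.submodule_iSup_eq_top]
    trivial
  have hexp : ∀ p : ℤ,
      Submodule.map (expEnd Y) (F p) ⊓ (LinearMap.ker H ⊓ LinearMap.ker Y) =
        F p ⊓ (LinearMap.ker H ⊓ LinearMap.ker Y) := by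
    intro p
    ext v
    constructor
    · rintro ⟨⟨f, hf, rfl⟩, hv⟩
      refine ⟨?_, hv⟩
      rw [SlTwoHodge.expEnd_apply_eq_self hnil hv.2]
      exact hf
    · rintro ⟨hf, hv⟩
      exact ⟨⟨v, hf, SlTwoHodge.expEnd_apply_of_mem_ker hv.2⟩, hv⟩
  refine ⟨hcomp, ?_, fun p p' hp v hv w hw => horth p p' hp v hv.1 w hw.1,
    fun p v hv => hpos p v hv.1, ?_, hexp⟩
  · refine le_antisymm (iSup_le fun p => inf_le_right) fun v hv => ?_
    obtain ⟨s, hs, hsv⟩ := hdec v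
    have hI := hcomp v hv s hs hsv.symm
    rw [← hsv]
    exact Submodule.sum_mem _ fun p _ => Submodule.mem_iSup_of_mem p ⟨hs p, hI p⟩
  · intro p
    rw [← hexp]
    refine le_antisymm (iSup₂_le fun i hi => inf_le_inf_right _ (inf_le_left.trans (hG hi)))
      fun v hv => ?_
    obtain ⟨s, hs, hsv⟩ := hdec v
    have hI := hcomp v hv.2 s hs hsv.symm
    have hlow : ∀ i, i < p → s i = 0 := by
      intro i hi
      by_contra h0
      have h1 : Q (s i) v = 0 := (hs i).2 v (hG (Int.add_one_le_iff.2 hi) hv.1)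
      have h2 : Q (s i) v = Q (s i) (s i) := by
        rw [← hsv, Finsupp.sum, map_sum]
        refine Finset.sum_eq_single i (fun j _ hj => horth i j hj.symm _ (hs i) _ (hs j)) ?_
        intro h
        rw [Finsupp.notMem_support_iff.1 h, map_zero]
      have h3 := (hpos i _ (hs i) h0).2
      rw [← h2, h1, mul_zero] at h3
      exact lt_irrefl _ h3
    rw [← hsv]
    refine Submodule.sum_mem _ fun i hi => ?_
    have hpi : p ≤ i := by
      by_contra h
      exact Finsupp.mem_support_iff.1 hi (hlow i (not_le.1 h))
    exact Submodule.mem_iSup_of_mem i (Submodule.mem_iSup_of_mem hpi ⟨hs i, hI i⟩)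
end

section
/- Let V be a finite-dimensional complex vector space graded as V = ⊕_{k∈ℤ} V_k, let H be the endomorphism acting as multiplication by k on V_k, and let Y be a nilpotent endomorphism with [H, Y] = −2Y (it is NOT assumed that Y^k : V_k → V_{−k} is an isomorphism). Let Q be a hermitian pairing on V with H† = −H and Y† = Y, and let F be a decreasing filtration of V with Y(F^p) ⊆ F^{p−1} and H(F^p) = F^p for all p, such that e^Y F is the Hodge filtration of a Hodge structure of weight n on V polarized by Q. Then Y^k : V_k → V_{−k} is an isomorphism for every k ≥ 0; consequently there exists X ∈ End(V) with [H,X] = 2X and [X,Y] = H, and a bigrading of V making (V, H, X, Y) an sl₂-Hodge structure of weight n with total Hodge filtration F, polarized by Q. -/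
/-- The Weil element `w = e^X e^{−Y} e^X`. -/
noncomputable def weil {V : Type*} [AddCommGroup V] [Module ℂ V] [FiniteDimensional ℂ V]
    (X Y : V →ₗ[ℂ] V) : V →ₗ[ℂ] V :=
  expEnd X ∘ₗ expEnd (-Y) ∘ₗ expEnd X

/-- `Vb` is a bigrading making `(V, H, X, Y)` an sl₂-Hodge structure of weight `n`
whose total Hodge filtration is `F`. -/
def IsSl2HodgeBigrading {V : Type*} [AddCommGroup V] [Module ℂ V]
    (n : ℤ) (H X Y : V →ₗ[ℂ] V) (F : ℤ → Submodule ℂ V)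
    (Vb : ℤ → ℤ → Submodule ℂ V) : Prop :=
  DirectSum.IsInternal (fun ij : ℤ × ℤ => Vb ij.1 ij.2) ∧
  (∀ i j : ℤ, ∀ v ∈ Vb i j, H v = ((i + j - n : ℤ) : ℂ) • v) ∧
  (∀ i j : ℤ, Submodule.map X (Vb i j) ≤ Vb (i + 1) (j + 1)) ∧
  (∀ i j : ℤ, Submodule.map Y (Vb i j) ≤ Vb (i - 1) (j - 1)) ∧
  (∀ p : ℤ, F p = ⨆ i : ℤ, ⨆ (_ : p ≤ i), ⨆ j : ℤ, Vb i j)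

open Module

theorem pow_finrank_eq_zero_of_isNilpotent {V : Type*} [AddCommGroup V] [Module ℂ V]
    [FiniteDimensional ℂ V] {A : End ℂ V} (h : IsNilpotent A) : A ^ finrank ℂ V = 0 := by
  have := A.aeval_self_charpoly
  rwa [h.charpoly_eq_X_pow_finrank, map_pow, Polynomial.aeval_X] at this

/-- A hermitian positive definite sesquilinear form, linear in the first variable. -/
structure IsHermInner {V : Type*} [AddCommGroup V] [Module ℂ V]
    (h : V →ₗ[ℂ] V →ₛₗ[starRingEnd ℂ] ℂ) : Prop where
  herm : ∀ v w, h w v = starRingEnd ℂ (h v w)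
  pos : ∀ v, v ≠ 0 → 0 < (h v v).re

/-- `A'` is adjoint to `A` with respect to the sesquilinear form `h`. -/
def IsAdj {V : Type*} [AddCommGroup V] [Module ℂ V]
    (h : V →ₗ[ℂ] V →ₛₗ[starRingEnd ℂ] ℂ) (A A' : End ℂ V) : Prop :=
  ∀ v w, h (A v) w = h v (A' w)

section IsAdj

variable {V : Type*} [AddCommGroup V] [Module ℂ V]
  {h : V →ₗ[ℂ] V →ₛₗ[starRingEnd ℂ] ℂ} {A A' B B' : End ℂ V}

theorem IsAdj.add (hA : IsAdj h A A') (hB : IsAdj h B B') : IsAdj h (A + B) (A' + B') := by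
  intro v w; simp [hA v w, hB v w]

theorem IsAdj.sub (hA : IsAdj h A A') (hB : IsAdj h B B') : IsAdj h (A - B) (A' - B') := by
  intro v w; simp [hA v w, hB v w]

theorem IsAdj.neg (hA : IsAdj h A A') : IsAdj h (-A) (-A') := by
  intro v w; simp [hA v w]

theorem IsAdj.mul (hA : IsAdj h A A') (hB : IsAdj h B B') : IsAdj h (A * B) (B' * A') := by
  intro v w; simp [hA _ w, hB v _]

theorem IsAdj.pow (hA : IsAdj h A A') (k : ℕ) : IsAdj h (A ^ k) (A' ^ k) := by
  induction k with
  | zero => intro v w; simp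
  | succ k ih => rw [pow_succ, pow_succ']; exact ih.mul hA

theorem IsAdj.symm (hh : ∀ v w, h w v = starRingEnd ℂ (h v w)) (hA : IsAdj h A A') :
    IsAdj h A' A := by
  intro v w; rw [hh, ← hA, ← hh]

theorem IsHermInner.eq_zero (hh : IsHermInner h) {v : V} (hv : h v v = 0) : v = 0 := by
  by_contra h0
  have := hh.pos v h0
  simp [hv] at this

theorem IsHermInner.adj_eq_zero (hh : IsHermInner h) (hA : IsAdj h A A') (h0 : A = 0) :
    A' = 0 := by
  ext v
  refine hh.eq_zero ?_
  rw [hA.symm hh.herm, h0]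
  simp

end IsAdj

section Trace

variable {V : Type*} [AddCommGroup V] [Module ℂ V] [FiniteDimensional ℂ V]
  {h : V →ₗ[ℂ] V →ₛₗ[starRingEnd ℂ] ℂ}

/-- The inner product space core (antilinear in the first variable) defined by `h`. -/
@[reducible]
noncomputable def IsHermInner.core (hh : IsHermInner h) : InnerProductSpace.Core ℂ V where
  inner v w := h w v
  conj_inner_symm v w := (hh.herm v w).symm
  re_inner_nonneg v := by
    rcases eq_or_ne v 0 with rfl | hv
    · simp
    · exact (hh.pos v hv).le
  add_left v w x := by simp
  smul_left v w c := by simp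
  definite v hv := hh.eq_zero hv

theorem IsHermInner.exists_trace_eq_sum (hh : IsHermInner h) :
    ∃ b : Basis (Fin (finrank ℂ V)) ℂ V, ∀ T : End ℂ V,
      LinearMap.trace ℂ V T = ∑ i, h (T (b i)) (b i) := by
  let := hh.core
  let : NormedAddCommGroup V := InnerProductSpace.Core.toNormedAddCommGroup (𝕜 := ℂ)
  let : InnerProductSpace ℂ V := InnerProductSpace.ofCore hh.core.toCore
  refine ⟨(stdOrthonormalBasis ℂ V).toBasis, fun T => ?_⟩
  rw [LinearMap.trace_eq_sum_inner T (stdOrthonormalBasis ℂ V)]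
  simp only [OrthonormalBasis.coe_toBasis]
  rfl

theorem IsHermInner.trace_nonneg (hh : IsHermInner h) {A A' : End ℂ V} (hA : IsAdj h A A') :
    0 ≤ (LinearMap.trace ℂ V (A' * A)).re ∧
      ((LinearMap.trace ℂ V (A' * A)).re = 0 → A = 0) := by
  obtain ⟨b, hb⟩ := hh.exists_trace_eq_sum
  have hnn : ∀ v, 0 ≤ (h v v).re := fun v => by
    rcases eq_or_ne v 0 with rfl | hv
    · simp
    · exact (hh.pos v hv).le
  have key : (LinearMap.trace ℂ V (A' * A)).re = ∑ i, (h (A (b i)) (A (b i))).re := by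
    rw [hb, Complex.re_sum]
    refine Finset.sum_congr rfl fun i _ => ?_
    rw [Module.End.mul_apply, hA.symm hh.herm]
  rw [key]
  refine ⟨Finset.sum_nonneg fun i _ => hnn _, fun h0 => ?_⟩
  rw [Finset.sum_eq_zero_iff_of_nonneg fun i _ => hnn _] at h0
  refine b.ext fun i => ?_
  by_contra hne
  exact (hh.pos _ hne).ne' (h0 i (Finset.mem_univ i))

/-- The rigidity statement behind the splitting: if `B` is self-adjoint, `K` is skew-adjoint and
the degree `-1` and degree `0` parts of the relation `[H, Y] = -2Y` hold for
`Y = A + B - A'` and `H = K - 2A - 2A'`, then `K` commutes with `A`, `B` and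
`[B, A] = -A`. -/
theorem IsHermInner.commute_of_bracket (hh : IsHermInner h) {A A' B K : End ℂ V}
    (hA : IsAdj h A A') (hB : IsAdj h B B) (hK : IsAdj h K (-K))
    (h1 : K * A - A * K + 2 * (B * A - A * B) + 2 * A = 0)
    (h0 : K * B - B * K + 4 * (A * A' - A' * A) + 2 * B = 0) :
    K * B = B * K ∧ B * A - A * B + A = 0 ∧ K * A = A * K := by
  set S : End ℂ V := B * A - A * B + A with hS
  set S' : End ℂ V := A' * B - B * A' + A' with hS'
  set R : End ℂ V := K * B - B * K with hR
  have adjS : IsAdj h S S' := ((hB.mul hA).sub (hA.mul hB)).add hA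
  have adjR : IsAdj h R R := by
    have : R = B * -K - -K * B := by rw [hR]; noncomm_ring
    intro v w
    nth_rw 2 [this]
    exact (hK.mul hB).sub (hB.mul hK) v w
  have h1' : A' * K - K * A' = 2 * S' := by
    have adj := ((((hK.mul hA).sub (hA.mul hK)).add (((hB.mul hA).sub (hA.mul hB)).add
      ((hB.mul hA).sub (hA.mul hB)))).add (hA.add hA))
    have := hh.adj_eq_zero adj (by rw [← h1]; noncomm_ring)
    rw [hS']
    linear_combination (norm := noncomm_ring) -this
  have h1s : K * A - A * K = -2 * S := by
    rw [hS]; linear_combination (norm := noncomm_ring) h1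
  have hBR : B * R - R * B = -4 * ((S * A' - A' * S) - (A * S' - S' * A)) := by
    have : R = -2 * B - 4 * (A * A' - A' * A) := by
      linear_combination (norm := noncomm_ring) h0
    rw [this, hS, hS']; noncomm_ring
  set τ := LinearMap.trace ℂ V
  have cyc : ∀ x y : End ℂ V, τ (x * y) = τ (y * x) := LinearMap.trace_mul_comm ℂ
  have e1 : τ (R * R) = τ (K * (B * R - R * B)) := by
    have : R * R = K * (B * R - R * B) + (K * R * B - B * (K * R)) := by
      nth_rw 1 [hR]; noncomm_ring
    rw [this, map_add, map_sub, cyc (K * R) B, sub_self, add_zero]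
  have e2 : τ (K * (S * A' - A' * S)) = τ (S * (A' * K - K * A')) := by
    have : K * (S * A' - A' * S) = S * (A' * K - K * A') + (K * (S * A') - S * A' * K)
      + (S * (K * A') - K * A' * S) := by noncomm_ring
    rw [this, map_add, map_add, map_sub, map_sub, cyc K (S * A'), cyc S (K * A'), sub_self,
      sub_self, add_zero,
      add_zero]
  have e3 : τ (K * (A * S' - S' * A)) = τ ((K * A - A * K) * S') := by
    have : K * (A * S' - S' * A) = (K * A - A * K) * S' + (A * (K * S') - K * S' * A) := by
      noncomm_ring
    rw [this, map_add, map_sub, cyc A, sub_self, add_zero]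
  have e4 : τ (R * R) = -16 * τ (S' * S) := by
    have : K * (B * R - R * B) =
        (-4 : ℂ) • (K * (S * A' - A' * S)) + (4 : ℂ) • (K * (A * S' - S' * A)) := by
      rw [hBR]
      simp only [mul_sub, neg_mul, mul_neg, smul_sub, neg_smul]
      have h4 : (4 : End ℂ V) = algebraMap ℂ (End ℂ V) 4 := (map_ofNat _ 4).symm
      rw [h4]
      simp only [← Algebra.smul_def, mul_smul_comm]
      abel
    rw [e1, this, map_add, map_smul, map_smul, e2, e3, h1', h1s]
    have : ∀ T : End ℂ V, (-2 : End ℂ V) * T = (-2 : ℂ) • T := fun T => by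
      rw [Algebra.smul_def, map_neg, map_ofNat]
    have this' : ∀ T : End ℂ V, (2 : End ℂ V) * T = (2 : ℂ) • T := fun T => by
      rw [Algebra.smul_def, map_ofNat]
    rw [this, this', mul_smul_comm, smul_mul_assoc, map_smul, map_smul, cyc S S']
    simp only [smul_eq_mul]; ring
  obtain ⟨r1, r2⟩ := hh.trace_nonneg adjR
  obtain ⟨s1, s2⟩ := hh.trace_nonneg adjS
  have e5 : (τ (R * R)).re = -16 * (τ (S' * S)).re := by rw [e4]; simp
  have hR0 : R = 0 := r2 (by linarith)
  have hS0 : S = 0 := s2 (by linarith)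
  refine ⟨sub_eq_zero.mp hR0, hS0, sub_eq_zero.mp ?_⟩
  rw [h1s, hS0, mul_zero]

end Trace

section Internal

variable {V : Type*} [AddCommGroup V] [Module ℂ V]

theorem DirectSum.IsInternal.end_ext {ι : Type*} [DecidableEq ι] {U : ι → Submodule ℂ V}
    (hU : DirectSum.IsInternal U) {S T : End ℂ V} (h : ∀ p, ∀ x ∈ U p, S x = T x) : S = T := by
  ext x
  have hx : x ∈ ⨆ p, U p := by rw [hU.submodule_iSup_eq_top]; trivial
  induction hx using Submodule.iSup_induction' with
  | mem p x hx => exact h p x hx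
  | zero => simp
  | add x y _ _ hx hy => simp [hx, hy]

theorem DirectSum.IsInternal.isAdj {ι : Type*} [DecidableEq ι] {U : ι → Submodule ℂ V}
    (hU : DirectSum.IsInternal U) {Q : V →ₗ[ℂ] V →ₛₗ[starRingEnd ℂ] ℂ} {S T : End ℂ V}
    (h : ∀ p q, ∀ x ∈ U p, ∀ y ∈ U q, Q (S x) y = Q x (T y)) : IsAdj Q S T := by
  intro x y
  have hx : x ∈ ⨆ p, U p := by rw [hU.submodule_iSup_eq_top]; trivial
  have hy : y ∈ ⨆ p, U p := by rw [hU.submodule_iSup_eq_top]; trivial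
  induction hx using Submodule.iSup_induction' with
  | mem p x hx =>
    induction hy using Submodule.iSup_induction' with
    | mem q y hy => exact h p q x hx y hy
    | zero => simp
    | add y y' _ _ hy hy' => simp [hy, hy']
  | zero => simp
  | add x x' _ _ hx hx' => simp [hx, hx']

/-- `π` is the family of projections of an internal direct sum decomposition, vanishing
outside of the finite set `s`. -/
structure IsProjFamily {ι : Type*} (U : ι → Submodule ℂ V) (π : ι → End ℂ V)
    (s : Finset ι) : Prop where
  mem : ∀ p x, π p x ∈ U p
  same : ∀ p, ∀ x ∈ U p, π p x = x
  ne : ∀ p q, p ≠ q → ∀ x ∈ U p, π q x = 0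
  sum : ∀ x, ∑ p ∈ s, π p x = x
  supp : ∀ p, p ∉ s → π p = 0

theorem DirectSum.IsInternal.exists_isProjFamily [FiniteDimensional ℂ V] {ι : Type*}
    [DecidableEq ι] {U : ι → Submodule ℂ V} (hU : DirectSum.IsInternal U) :
    ∃ π s, IsProjFamily U π s := by
  let := hU.chooseDecomposition
  let π : ι → End ℂ V := fun p => (U p).subtype ∘ₗ DirectSum.component ℂ ι _ p ∘ₗ
    (DirectSum.decomposeLinearEquiv U).toLinearMap
  have hπ : ∀ p x, π p x = DirectSum.decompose U x p := fun p x => rfl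
  have hfin := WellFoundedGT.finite_ne_bot_of_iSupIndep hU.submodule_iSupIndep
  have mem : ∀ p x, π p x ∈ U p := fun p x => (DirectSum.decompose U x p).2
  have same : ∀ p, ∀ x ∈ U p, π p x = x := fun p x hx => by
    rw [hπ, DirectSum.decompose_of_mem_same U hx]
  have ne : ∀ p q, p ≠ q → ∀ x ∈ U p, π q x = 0 := fun p q hpq x hx => by
    rw [hπ, DirectSum.decompose_of_mem_ne U hx hpq]
  have hbot : ∀ p, p ∉ hfin.toFinset → U p = ⊥ := fun p hp => by simpa using hp
  refine ⟨π, hfin.toFinset, mem, same, ne, fun x => ?_, fun p hp => ?_⟩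
  · have : ∑ p ∈ hfin.toFinset, π p = (1 : End ℂ V) := by
      refine hU.end_ext fun q x hx => ?_
      rw [LinearMap.sum_apply, Finset.sum_eq_single q (fun p _ hp => ne q p hp.symm x hx)
        (fun hq => ?_), same q x hx, Module.End.one_apply]
      have := hbot q hq ▸ mem q x
      simpa using this
    simpa using congrArg (fun T : End ℂ V => T x) this
  · ext x
    have := hbot p hp ▸ mem p x
    simpa using this

namespace IsProjFamily

variable {ι : Type*} {U : ι → Submodule ℂ V} {π : ι → End ℂ V} {s : Finset ι}

theorem eq_zero (hπ : IsProjFamily U π s) {x : V} (h : ∀ q, π q x = 0) : x = 0 := by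
  rw [← hπ.sum x]; exact Finset.sum_eq_zero fun q _ => h q

theorem mem_of (hπ : IsProjFamily U π s) {x : V} {p : ι} (h : ∀ q, q ≠ p → π q x = 0) :
    x ∈ U p := by
  rw [← hπ.sum x]
  refine Submodule.sum_mem _ fun q _ => ?_
  by_cases hq : q = p
  · exact hq ▸ hπ.mem q x
  · rw [h q hq]; exact zero_mem _

theorem apply_apply_same (hπ : IsProjFamily U π s) (p : ι) (x : V) : π p (π p x) = π p x :=
  hπ.same p _ (hπ.mem p x)

theorem apply_apply_ne (hπ : IsProjFamily U π s) {p q : ι} (h : p ≠ q) (x : V) :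
    π q (π p x) = 0 :=
  hπ.ne p q h _ (hπ.mem p x)

/-- A linear map can be prescribed on the summands through a family of linear maps. -/
theorem exists_end (hπ : IsProjFamily U π s) (f : ι → End ℂ V) :
    ∃ T : End ℂ V, ∀ p, ∀ x ∈ U p, T x = f p x := by
  classical
  refine ⟨∑ p ∈ s, f p * π p, fun p x hx => ?_⟩
  rw [LinearMap.sum_apply, Finset.sum_eq_single p]
  · rw [Module.End.mul_apply, hπ.same p x hx]
  · intro q _ hq
    rw [Module.End.mul_apply, hπ.ne p q hq.symm x hx, map_zero]
  · intro hp
    rw [Module.End.mul_apply, hπ.supp p hp, LinearMap.zero_apply, map_zero]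

end IsProjFamily

/-- The projections of a grading commute with the endomorphisms preserving the summands. -/
theorem IsProjFamily.apply_comm {ι : Type*} [DecidableEq ι] {U : ι → Submodule ℂ V}
    {π : ι → End ℂ V} {s : Finset ι} (hπ : IsProjFamily U π s) (hU : DirectSum.IsInternal U)
    {T : End ℂ V} (hT : ∀ p, ∀ x ∈ U p, T x ∈ U p) (q : ι) (x : V) : π q (T x) = T (π q x) := by
  have : π q * T = T * π q := hU.end_ext fun r y hy => by
    rw [Module.End.mul_apply, Module.End.mul_apply]
    rcases eq_or_ne r q with rfl | hr
    · rw [hπ.same _ _ hy, hπ.same _ _ (hT _ _ hy)]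
    · rw [hπ.ne _ _ hr _ hy, hπ.ne _ _ hr _ (hT _ _ hy), map_zero]
  exact LinearMap.congr_fun this x

/-- The summands of a `ℤ`-grading are the eigenspaces of the grading operator. -/
theorem DirectSum.IsInternal.mem_iff_of_grading [FiniteDimensional ℂ V]
    {U : ℤ → Submodule ℂ V} (hU : DirectSum.IsInternal U) {D : End ℂ V}
    (hD : ∀ p, ∀ x ∈ U p, D x = (p : ℂ) • x) (p : ℤ) (x : V) :
    x ∈ U p ↔ D x = (p : ℂ) • x := by
  obtain ⟨π, s, hπ⟩ := hU.exists_isProjFamily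
  refine ⟨hD p x, fun hx => hπ.mem_of fun q hq => ?_⟩
  have h1 := hπ.apply_comm hU (fun r y hy => hD r y hy ▸ Submodule.smul_mem _ _ hy) q x
  rw [hx, map_smul, hD q _ (hπ.mem q x), ← sub_eq_zero, ← sub_smul, smul_eq_zero, sub_eq_zero,
    Int.cast_inj] at h1
  exact h1.resolve_left hq.symm

end Internal

section Hodge

variable {V : Type*} [AddCommGroup V] [Module ℂ V]

/-- The Hodge decomposition `V = ⊕ U p` of a weight-`n` Hodge structure with Hodge filtration `W`
polarized by the hermitian pairing `Q`. -/
structure IsPolarizedHodge (n : ℤ) (Q : V →ₗ[ℂ] V →ₛₗ[starRingEnd ℂ] ℂ)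
    (W U : ℤ → Submodule ℂ V) : Prop where
  herm : ∀ v w : V, Q w v = starRingEnd ℂ (Q v w)
  anti : Antitone W
  eq : ∀ p, U p = W p ⊓ annQ Q (W (p + 1))
  internal : DirectSum.IsInternal U
  orth : ∀ p q, p ≠ q → ∀ v ∈ U p, ∀ w ∈ U q, Q v w = 0
  pos : ∀ p, ∀ v ∈ U p, v ≠ 0 → posC ((-1 : ℂ) ^ (n - p) * Q v v)

namespace IsPolarizedHodge

variable {n : ℤ} {Q : V →ₗ[ℂ] V →ₛₗ[starRingEnd ℂ] ℂ} {W U : ℤ → Submodule ℂ V}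
  {π : ℤ → End ℂ V} {s : Finset ℤ}

theorem eq_zero (hW : IsPolarizedHodge n Q W U) {p : ℤ} {v : V} (hv : v ∈ U p)
    (h : Q v v = 0) : v = 0 := by
  by_contra h0
  have := (hW.pos p v hv h0).2
  simp [h] at this

theorem isAdj_proj (hW : IsPolarizedHodge n Q W U) (hπ : IsProjFamily U π s) (r : ℤ) :
    IsAdj Q (π r) (π r) := by
  refine hW.internal.isAdj fun p q x hx y hy => ?_
  rcases eq_or_ne p r with rfl | hp <;> rcases eq_or_ne q p with rfl | hq
  · rw [hπ.same _ x hx, hπ.same _ y hy]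
  · rw [hπ.same _ x hx, hW.orth _ _ hq.symm _ hx _ hy, hπ.ne _ _ hq _ hy, map_zero]
  · rw [hπ.ne _ _ hp _ hx, hπ.ne _ _ hp _ hy]; simp
  · rcases eq_or_ne q r with rfl | hqr
    · rw [hπ.ne _ _ hp _ hx, hπ.same _ y hy, hW.orth _ _ hp _ hx _ hy]; simp
    · rw [hπ.ne _ _ hp _ hx, hπ.ne _ _ hqr _ hy]; simp

theorem proj_eq_zero_of_mem (hW : IsPolarizedHodge n Q W U) (hπ : IsProjFamily U π s)
    {p q : ℤ} {x : V} (hx : x ∈ W p) (hq : q < p) : π q x = 0 := by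
  refine hW.eq_zero (hπ.mem q x) ?_
  rw [← hW.isAdj_proj hπ q, hπ.apply_apply_same]
  have := hπ.mem q x
  rw [hW.eq] at this
  exact this.2 x (hW.anti (by omega) hx)

theorem proj_eq_zero_of_mem_annQ (hW : IsPolarizedHodge n Q W U) (hπ : IsProjFamily U π s)
    {p q : ℤ} {x : V} (hx : x ∈ annQ Q (W (p + 1))) (hq : p < q) : π q x = 0 := by
  refine hW.eq_zero (hπ.mem q x) ?_
  rw [hW.isAdj_proj hπ q, hπ.apply_apply_same]
  have := hπ.mem q x
  rw [hW.eq] at this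
  exact hx _ (hW.anti (by omega) this.1)

theorem exists_hermInner [FiniteDimensional ℂ V] (hW : IsPolarizedHodge n Q W U) :
    ∃ C : End ℂ V, (∀ p, ∀ x ∈ U p, C x = ((-1 : ℂ) ^ (n - p)) • x) ∧
      IsHermInner (Q.compl₂ C) := by
  obtain ⟨π, s, hπ⟩ := hW.internal.exists_isProjFamily
  obtain ⟨C, hC⟩ := hπ.exists_end fun p => ((-1 : ℂ) ^ (n - p)) • (1 : End ℂ V)
  simp only [LinearMap.smul_apply, Module.End.one_apply] at hC
  have hCadj : IsAdj Q C C := by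
    refine hW.internal.isAdj fun p q x hx y hy => ?_
    rw [hC p x hx, hC q y hy]
    rcases eq_or_ne p q with rfl | hpq
    · simp
    · simp [hW.orth p q hpq x hx y hy]
  refine ⟨C, hC, fun v w => ?_, fun v hv => ?_⟩
  · rw [LinearMap.compl₂_apply, LinearMap.compl₂_apply, ← hCadj, hW.herm]
  · have h1 : Q v (C v) = ∑ q ∈ s, (-1 : ℂ) ^ (n - q) * Q (π q v) (π q v) := by
      have h2 : C v = ∑ q ∈ s, ((-1 : ℂ) ^ (n - q)) • π q v := by
        conv_lhs => rw [← hπ.sum v, map_sum]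
        exact Finset.sum_congr rfl fun q _ => hC q _ (hπ.mem q v)
      rw [h2, map_sum]
      refine Finset.sum_congr rfl fun q _ => ?_
      rw [hW.isAdj_proj hπ q, hπ.apply_apply_same]
      simp
    have hterm : ∀ q, 0 ≤ ((-1 : ℂ) ^ (n - q) * Q (π q v) (π q v)).re := fun q => by
      rcases eq_or_ne (π q v) 0 with h0 | h0
      · simp [h0]
      · exact (hW.pos q _ (hπ.mem q v) h0).2.le
    rw [LinearMap.compl₂_apply, h1, Complex.re_sum]
    refine lt_of_le_of_ne (Finset.sum_nonneg fun q _ => hterm q) fun h0 => hv ?_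
    rw [eq_comm, Finset.sum_eq_zero_iff_of_nonneg fun q _ => hterm q] at h0
    rw [← hπ.sum v]
    refine Finset.sum_eq_zero fun q hq => ?_
    by_contra hne
    exact (hW.pos q _ (hπ.mem q v) hne).2.ne' (h0 q hq)

/-- The Hodge filtration is the filtration induced by the Hodge decomposition. -/
theorem eq_iSup [FiniteDimensional ℂ V] (hW : IsPolarizedHodge n Q W U) (p : ℤ) :
    W p = ⨆ (q : ℤ) (_ : p ≤ q), U q := by
  obtain ⟨π, s, hπ⟩ := hW.internal.exists_isProjFamily
  refine le_antisymm (fun x hx => ?_) (iSup₂_le fun q hq => ?_)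
  · rw [← hπ.sum x]
    refine Submodule.sum_mem _ fun q _ => ?_
    rcases lt_or_ge q p with hq | hq
    · rw [hW.proj_eq_zero_of_mem hπ hx hq]; exact zero_mem _
    · exact Submodule.mem_iSup_of_mem q (Submodule.mem_iSup_of_mem hq (hπ.mem q x))
  · rw [hW.eq]
    exact inf_le_left.trans (hW.anti hq)

end IsPolarizedHodge

/-- `T` is homogeneous of degree `d` for the grading operator `D`. -/
def IsDeg (D : End ℂ V) (d : ℤ) (T : End ℂ V) : Prop := D * T - T * D = d • T

theorem IsPolarizedHodge.exists_splitting [FiniteDimensional ℂ V] {n : ℤ}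
    {Q : V →ₗ[ℂ] V →ₛₗ[starRingEnd ℂ] ℂ}
    {W U : ℤ → Submodule ℂ V} (hW : IsPolarizedHodge n Q W U) {H Y : End ℂ V}
    (hQH : IsAdj Q H (-H)) (hQY : IsAdj Q Y Y)
    (hYW : ∀ p, ∀ x ∈ W p, Y x ∈ W (p - 1))
    (hHW : ∀ p, ∀ x ∈ W p, H x + (Y x + Y x) ∈ W p) :
    ∃ (D A B A' K : End ℂ V) (h : V →ₗ[ℂ] V →ₛₗ[starRingEnd ℂ] ℂ),
      (∀ p x, x ∈ U p ↔ D x = (p : ℂ) • x) ∧ IsHermInner h ∧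
      IsAdj Q D D ∧ IsAdj Q A (-A') ∧ IsAdj Q B B ∧
      IsAdj h A A' ∧ IsAdj h B B ∧ IsAdj h K (-K) ∧
      IsDeg D (-1) A ∧ IsDeg D 0 B ∧ IsDeg D 1 A' ∧ IsDeg D 0 K ∧
      Y = A + B - A' ∧ H = K - 2 * A - 2 * A' := by
  obtain ⟨π, s, hπ⟩ := hW.internal.exists_isProjFamily
  obtain ⟨C, hC, hCh⟩ := hW.exists_hermInner
  obtain ⟨D, hD⟩ := hπ.exists_end fun p => (p : ℂ) • (1 : End ℂ V)
  obtain ⟨A, hA⟩ := hπ.exists_end fun p => π (p - 1) * Y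
  obtain ⟨B, hB⟩ := hπ.exists_end fun p => π p * Y
  obtain ⟨A', hA'⟩ := hπ.exists_end fun p => -(π (p + 1) * Y)
  simp only [LinearMap.smul_apply, LinearMap.neg_apply, Module.End.one_apply,
    Module.End.mul_apply] at hD hA hB hA'
  have memA : ∀ p, ∀ x ∈ U p, A x ∈ U (p - 1) := fun p x hx => hA p x hx ▸ hπ.mem _ _
  have memB : ∀ p, ∀ x ∈ U p, B x ∈ U p := fun p x hx => hB p x hx ▸ hπ.mem _ _
  have memA' : ∀ p, ∀ x ∈ U p, A' x ∈ U (p + 1) := fun p x hx =>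
    hA' p x hx ▸ neg_mem (hπ.mem _ _)
  have memW : ∀ p, ∀ x ∈ U p, x ∈ W p := fun p x hx => by rw [hW.eq] at hx; exact hx.1
  have memAnn : ∀ p, ∀ x ∈ U p, x ∈ annQ Q (W (p + 1)) := fun p x hx => by
    rw [hW.eq] at hx; exact hx.2
  have Ylow : ∀ p q, ∀ x ∈ U p, q < p - 1 → π q (Y x) = 0 := fun p q x hx hq =>
    hW.proj_eq_zero_of_mem hπ (hYW p x (memW p x hx)) hq
  have Yhigh : ∀ p q, ∀ x ∈ U p, p + 1 < q → π q (Y x) = 0 := fun p q x hx hq =>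
    hW.proj_eq_zero_of_mem_annQ hπ (p := p + 1) (fun y hy => by
      rw [hQY]
      exact memAnn p x hx _ (by simpa using hYW _ y hy)) hq
  have hY : Y = A + B - A' := by
    refine hW.internal.end_ext fun p x hx => ?_
    rw [LinearMap.sub_apply, LinearMap.add_apply, hA p x hx, hB p x hx, hA' p x hx, ← sub_eq_zero]
    refine hπ.eq_zero fun q => ?_
    simp only [map_sub, map_add, map_neg]
    rcases lt_trichotomy q p with hq | rfl | hq
    · rcases (by omega : q < p - 1 ∨ q = p - 1) with h | rfl
      · rw [Ylow p q x hx h, hπ.apply_apply_ne (by omega), hπ.apply_apply_ne (by omega),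
          hπ.apply_apply_ne (by omega)]
        simp
      · rw [hπ.apply_apply_same, hπ.apply_apply_ne (by omega), hπ.apply_apply_ne (by omega)]
        simp
    · rw [hπ.apply_apply_same, hπ.apply_apply_ne (by omega), hπ.apply_apply_ne (by omega)]
      simp
    · rcases (by omega : p + 1 < q ∨ q = p + 1) with h | rfl
      · rw [Yhigh p q x hx h, hπ.apply_apply_ne (by omega), hπ.apply_apply_ne (by omega),
          hπ.apply_apply_ne (by omega)]
        simp
      · rw [hπ.apply_apply_same, hπ.apply_apply_ne (by omega), hπ.apply_apply_ne (by omega)]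
        simp
  have memK : ∀ p, ∀ x ∈ U p, (H + 2 * A + 2 * A') x ∈ U p := fun p x hx => by
    have e : (H + 2 * A + 2 * A') x =
        H x + (π (p - 1) (Y x) + π (p - 1) (Y x)) - (π (p + 1) (Y x) + π (p + 1) (Y x)) := by
      simp only [two_mul, LinearMap.add_apply, hA p x hx, hA' p x hx]
      abel
    refine e ▸ hπ.mem_of fun q hq => ?_
    simp only [map_sub, map_add]
    rcases lt_or_gt_of_ne hq with h | h
    · have h1 := hW.proj_eq_zero_of_mem hπ (hHW p x (memW p x hx)) h
      rw [map_add, map_add] at h1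
      rw [hπ.apply_apply_ne (p := p + 1) (by omega)]
      rcases (by omega : q < p - 1 ∨ q = p - 1) with h' | rfl
      · rw [Ylow p q x hx h'] at h1
        rw [hπ.apply_apply_ne (by omega)]
        simpa using h1
      · rw [hπ.apply_apply_same]
        simpa using h1
    · have h1 := hW.proj_eq_zero_of_mem_annQ hπ (p := p) (x := H x - (Y x + Y x))
        (fun y hy => by
          have := memAnn p x hx _ (hHW _ y hy)
          simp only [map_add] at this
          simp only [map_sub, map_add, LinearMap.sub_apply, LinearMap.add_apply, hQH x y, hQY x y,
            LinearMap.neg_apply, map_neg]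
          linear_combination -this) h
      rw [map_sub, map_add] at h1
      rw [hπ.apply_apply_ne (p := p - 1) (by omega)]
      rcases (by omega : p + 1 < q ∨ q = p + 1) with h' | rfl
      · rw [Yhigh p q x hx h'] at h1
        rw [hπ.apply_apply_ne (by omega)]
        simpa using h1
      · rw [hπ.apply_apply_same]
        simpa using h1
  have degOf : ∀ (d : ℤ) (T : End ℂ V), (∀ p, ∀ x ∈ U p, T x ∈ U (p + d)) → IsDeg D d T :=
    fun d T hT => hW.internal.end_ext fun p x hx => by
      simp only [LinearMap.sub_apply, Module.End.mul_apply, LinearMap.smul_apply, hD p x hx,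
        hD _ _ (hT p x hx), map_smul, ← Int.cast_smul_eq_zsmul ℂ, ← sub_smul]
      push_cast
      ring_nf
  have QD : IsAdj Q D D := hW.internal.isAdj fun p q x hx y hy => by
    rw [hD p x hx, hD q y hy]
    rcases eq_or_ne p q with rfl | hpq
    · simp
    · simp [hW.orth p q hpq x hx y hy]
  have QA : IsAdj Q A (-A') := hW.internal.isAdj fun p q x hx y hy => by
    rw [LinearMap.neg_apply, hA p x hx, hA' q y hy, neg_neg, hW.isAdj_proj hπ,
      ← hW.isAdj_proj hπ (q + 1)]
    rcases eq_or_ne q (p - 1) with rfl | hpq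
    · rw [hπ.same _ y hy, hQY, sub_add_cancel, hπ.same _ x hx]
    · rw [hπ.ne _ _ hpq y hy, hπ.ne p (q + 1) (by omega) x hx]; simp
  have QB : IsAdj Q B B := hW.internal.isAdj fun p q x hx y hy => by
    rw [hB p x hx, hB q y hy, hW.isAdj_proj hπ, ← hW.isAdj_proj hπ q]
    rcases eq_or_ne q p with rfl | hpq
    · rw [hπ.same _ y hy, hQY, hπ.same _ x hx]
    · rw [hπ.ne _ _ hpq y hy, hπ.ne _ _ hpq.symm x hx]; simp
  have QA' : IsAdj Q A' (-A) := by simpa using (QA.symm hW.herm).neg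
  have QK : IsAdj Q (H + 2 * A + 2 * A') (-(H + 2 * A + 2 * A')) := by
    have := (hQH.add (QA.add QA)).add (QA'.add QA')
    have e : -H + (-A' + -A') + (-A + -A) = -(H + 2 * A + 2 * A') := by noncomm_ring
    rw [e] at this
    simpa only [two_mul] using this
  have neg_one_zpow : ∀ m : ℤ, (-1 : ℂ) ^ (m + 1) = -(-1) ^ m := fun m => by
    rw [zpow_add_one₀ (by norm_num)]; ring
  have CA' : A' * C = -(C * A') := hW.internal.end_ext fun p x hx => by
    have e := neg_one_zpow (n - (p + 1))
    rw [show n - (p + 1) + 1 = n - p by ring] at e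
    simp only [LinearMap.neg_apply, Module.End.mul_apply, hC p x hx, hC _ _ (memA' p x hx),
      map_neg, map_smul, e, neg_smul]
  have CB : B * C = C * B := hW.internal.end_ext fun p x hx => by
    simp only [Module.End.mul_apply, hC p x hx, hC _ _ (memB p x hx), map_smul]
  have CK : (H + 2 * A + 2 * A') * C = C * (H + 2 * A + 2 * A') :=
    hW.internal.end_ext fun p x hx => by
      rw [Module.End.mul_apply, Module.End.mul_apply, hC p x hx, hC _ _ (memK p x hx), map_smul]
  have hadj : ∀ S T T' : End ℂ V, IsAdj Q S T → T * C = C * T' → IsAdj (Q.compl₂ C) S T' :=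
    fun S T T' hS hT v w => by
      rw [LinearMap.compl₂_apply, LinearMap.compl₂_apply, hS, ← Module.End.mul_apply, hT,
        Module.End.mul_apply]
  refine ⟨D, A, B, A', H + 2 * A + 2 * A', Q.compl₂ C, hW.internal.mem_iff_of_grading hD, hCh, QD, QA, QB,
    hadj _ _ _ QA (by rw [neg_mul, CA', neg_neg]), hadj _ _ _ QB CB,
    hadj _ _ _ QK (by rw [neg_mul, CK, mul_neg]), degOf _ _ memA, degOf _ _ (by simpa using memB),
    degOf _ _ memA', degOf _ _ (by simpa using memK), hY, by abel⟩

end Hodge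

section Splitting

variable {V : Type*} [AddCommGroup V] [Module ℂ V]

namespace IsDeg

variable {D S T : End ℂ V} {d e : ℤ}

theorem add (hS : IsDeg D d S) (hT : IsDeg D d T) : IsDeg D d (S + T) := by
  unfold IsDeg at *
  rw [smul_add, ← hS, ← hT]
  noncomm_ring

theorem sub (hS : IsDeg D d S) (hT : IsDeg D d T) : IsDeg D d (S - T) := by
  unfold IsDeg at *
  rw [smul_sub, ← hS, ← hT]
  noncomm_ring

theorem mul (hS : IsDeg D d S) (hT : IsDeg D e T) : IsDeg D (d + e) (S * T) := by
  unfold IsDeg at *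
  rw [add_smul, ← smul_mul_assoc, ← mul_smul_comm, ← hS, ← hT]
  noncomm_ring

theorem two_mul (hS : IsDeg D d S) : IsDeg D d (2 * S) := by
  rw [_root_.two_mul]; exact hS.add hS

/-- The homogeneous components of zero vanish. -/
theorem eq_zero_of_sum {R : End ℂ V} (hR : IsDeg D (-1) R) (hS : IsDeg D 0 S) (hT : IsDeg D 1 T)
    (h : R + S + T = 0) : R = 0 ∧ S = 0 ∧ T = 0 := by
  unfold IsDeg at *
  rw [zero_smul] at hS
  rw [one_smul] at hT
  rw [neg_smul, one_smul] at hR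
  have h1 : T = R := by
    linear_combination (norm := noncomm_ring) D * h - h * D - hR - hS - hT
  have h2 : R + T = 0 := by
    linear_combination (norm := noncomm_ring) D * h1 - h1 * D - hT + hR
  have h3 : R = 0 := by
    rw [h1, ← two_smul ℂ] at h2
    simpa using h2
  refine ⟨h3, ?_, by rw [h1, h3]⟩
  rw [h1, h3] at h
  simpa using h

end IsDeg

theorem IsPolarizedHodge.exists_sl2 [FiniteDimensional ℂ V] {n : ℤ}
    {Q : V →ₗ[ℂ] V →ₛₗ[starRingEnd ℂ] ℂ} {W U : ℤ → Submodule ℂ V}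
    (hW : IsPolarizedHodge n Q W U) {H Y : End ℂ V}
    (hH : ∀ T : End ℂ V, (∀ (k : ℤ) v, H v = (k : ℂ) • v → T v = 0) → T = 0)
    (hY : IsNilpotent Y) (hHY : H * Y - Y * H = -(Y + Y))
    (hQH : IsAdj Q H (-H)) (hQY : IsAdj Q Y Y)
    (hYW : ∀ p, ∀ x ∈ W p, Y x ∈ W (p - 1))
    (hHW : ∀ p, ∀ x ∈ W p, H x + (Y x + Y x) ∈ W p) :
    ∃ X P D : End ℂ V, IsNilpotent X ∧ H * X - X * H = X + X ∧ X * Y - Y * X = H ∧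
      P * X - X * P = X ∧ P * Y - Y * P = -Y ∧ P * H = H * P ∧
      D + D = P + P - H + X + Y ∧
      IsAdj Q X X ∧ IsAdj Q P (P - H) ∧ (∀ p x, x ∈ U p ↔ D x = (p : ℂ) • x) ∧
      ∀ k : ℤ, 0 < k → ∀ u, H u = (k : ℂ) • u → X (Y u) = 0 → u = 0 := by
  obtain ⟨D, A, B, A', K, h, hD, hh, QD, QA, QB, hA, hB, hK, dA, dB, dA', dK, eY, eH⟩ :=
    hW.exists_splitting hQH hQY hYW hHW
  have hA' : IsAdj h A' A := hA.symm hh.herm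
  obtain ⟨h1, h0, -⟩ := IsDeg.eq_zero_of_sum (D := D)
    (R := K * A - A * K + 2 * (B * A - A * B) + 2 * A)
    (S := K * B - B * K + 2 * (2 * (A * A' - A' * A)) + 2 * B)
    (T := A' * K - K * A' + 2 * (B * A' - A' * B) - 2 * A')
    (((((dK.mul dA).sub (dA.mul dK)).add ((dB.mul dA).sub (dA.mul dB)).two_mul)).add dA.two_mul)
    ((((dK.mul dB).sub (dB.mul dK)).add
      ((dA.mul dA').sub (dA'.mul dA)).two_mul.two_mul).add dB.two_mul)
    ((((dA'.mul dK).sub (dK.mul dA')).add ((dB.mul dA').sub (dA'.mul dB)).two_mul).sub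
      dA'.two_mul) (by
      rw [eY, eH] at hHY
      linear_combination (norm := noncomm_ring) hHY)
  obtain ⟨KB, BA, KA⟩ := hh.commute_of_bracket hA hB hK h1
    (by linear_combination (norm := noncomm_ring) h0)
  have BA' : A' * B - B * A' + A' = 0 :=
    hh.adj_eq_zero (((hB.mul hA).sub (hA.mul hB)).add hA) BA
  have KA' : A' * -K - -K * A' = 0 :=
    hh.adj_eq_zero ((hK.mul hA).sub (hA.mul hK)) (sub_eq_zero.2 KA)
  have QA' : IsAdj Q A' (-A) := by simpa using (QA.symm hW.herm).neg
  have hHh : IsAdj h H (-K - 2 * A - 2 * A') := by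
    have := (hK.sub (hA.add hA)).sub (hA'.add hA')
    rw [← two_mul, ← two_mul] at this
    have e : -K - 2 * A - 2 * A' = -K - 2 * A' - 2 * A := by abel
    rwa [eH, e]
  have K0 : K = 0 := hH K fun k v hv => by
    have hL : IsAdj h (H - (k : ℂ) • 1) (H - 2 * K - (k : ℂ) • 1) := fun v w => by
      have e : H - 2 * K = -K - 2 * A - 2 * A' := by rw [eH]; noncomm_ring
      rw [e]
      simp only [LinearMap.sub_apply, LinearMap.smul_apply, map_sub, Module.End.one_apply, hHh v w,
        map_smul]
      simp
    have e0 : (H - 2 * K - (k : ℂ) • 1) v = 0 := by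
      have ec : (H - (k : ℂ) • 1) * (H - 2 * K - (k : ℂ) • 1) =
          (H - 2 * K - (k : ℂ) • 1) * (H - (k : ℂ) • 1) := by
        have c0 : H * (H - 2 * K) = (H - 2 * K) * H := by
          rw [eH]
          linear_combination (norm := noncomm_ring) -4 * KA - 4 * KA'
        rw [sub_mul, mul_sub, c0, sub_mul _ _ (H - _), mul_sub _ H]
        simp only [smul_mul_assoc, mul_smul_comm, one_mul, mul_one]
        module
      have ev : (H - (k : ℂ) • 1) v = 0 := by simp [hv]
      refine hh.eq_zero ?_
      rw [hL.symm hh.herm, ← Module.End.mul_apply, ec, Module.End.mul_apply, ev]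
      simp
    have : (2 : ℂ) • K v = 0 := by
      simp only [LinearMap.sub_apply, LinearMap.smul_apply, Module.End.one_apply, hv, two_mul,
        LinearMap.add_apply] at e0
      rw [two_smul]
      linear_combination (norm := module) -e0
    simpa using this
  subst K0
  have AA' : 2 * (A * A' - A' * A) + B = 0 := by
    have : (2 : ℂ) • (2 * (A * A' - A' * A) + B) = 0 := by
      rw [two_smul]
      linear_combination (norm := noncomm_ring) h0
    exact (smul_eq_zero.1 this).resolve_left two_ne_zero
  have hYX : IsAdj h Y (B + A' - A) := by
    have := (hA.add hB).sub hA'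
    rwa [← eY, add_comm A' B] at this
  have hXY : (B + A' - A) * Y - Y * (B + A' - A) = H := by
    rw [eY, eH]
    linear_combination (norm := noncomm_ring) 2 * BA + 2 * BA'
  have hDX : D * (B + A' - A) - (B + A' - A) * D = A' + A := by
    unfold IsDeg at dA dB dA'
    rw [neg_smul, one_smul] at dA
    rw [zero_smul] at dB
    rw [one_smul] at dA'
    linear_combination (norm := noncomm_ring) dB + dA' - dA
  have hDY : D * Y - Y * D = - A' - A := by
    unfold IsDeg at dA dB dA'
    rw [neg_smul, one_smul] at dA
    rw [zero_smul] at dB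
    rw [one_smul] at dA'
    rw [eY]
    linear_combination (norm := noncomm_ring) dB - dA' + dA
  have hDH : D * H - H * D = 2 * A - 2 * A' := by
    unfold IsDeg at dA dA'
    rw [neg_smul, one_smul] at dA
    rw [one_smul] at dA'
    rw [eH]
    linear_combination (norm := noncomm_ring) - 2 * dA' - 2 * dA
  refine ⟨B + A' - A, D - B - A - A', D, ?_, ?_, hXY, ?_, ?_, ?_, ?_, ?_, ?_, hD, ?_⟩
  · obtain ⟨N, hN⟩ := hY
    exact ⟨N, hh.adj_eq_zero (hYX.pow N) hN⟩
  · rw [eH]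
    linear_combination (norm := noncomm_ring) 2 * BA - 2 * BA' - 2 * AA'
  · linear_combination (norm := noncomm_ring) hDX - AA' + 2 * BA
  · rw [eY] at hDY ⊢
    linear_combination (norm := noncomm_ring) hDY + AA' - 2 * BA'
  · rw [eH] at hDH ⊢
    linear_combination (norm := noncomm_ring) hDH + 2 * BA - 2 * BA'
  · rw [eY, eH]
    noncomm_ring
  · have := (QB.add QA').sub QA
    have e : B + -A - -A' = B + A' - A := by abel
    rwa [e] at this
  · have := ((QD.sub QB).sub QA).sub QA'
    have e : D - B - -A' - -A = D - B - A - A' - H := by rw [eH]; noncomm_ring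
    rwa [e] at this
  · intro k hk u hu hXYu
    by_contra hne
    have hYu : Y u = 0 := hh.eq_zero (by rw [hYX, hXYu, map_zero])
    have e1 : Y ((B + A' - A) u) = -((k : ℂ) • u) := by
      have := LinearMap.congr_fun hXY u
      rwa [LinearMap.sub_apply, Module.End.mul_apply, Module.End.mul_apply, hXYu, hu, zero_sub,
        neg_eq_iff_eq_neg] at this
    have e2 := hYX.symm hh.herm u ((B + A' - A) u)
    rw [e1] at e2
    have e3 : h u (-((k : ℂ) • u)) = -((k : ℂ) * h u u) := by simp
    rw [e3] at e2
    have p1 := hh.pos u hne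
    have p2 : 0 ≤ (h ((B + A' - A) u) ((B + A' - A) u)).re := by
      rcases eq_or_ne ((B + A' - A) u) 0 with h0 | h0
      · simp [h0]
      · exact (hh.pos _ h0).le
    rw [e2] at p2
    simp only [Complex.neg_re, Complex.mul_re, Complex.intCast_re, Complex.intCast_im, zero_mul,
      sub_zero] at p2
    have : (0 : ℝ) < k := by exact_mod_cast hk
    nlinarith

end Splitting

section Sl2

variable {V : Type*} [AddCommGroup V] [Module ℂ V]

/-- The relations of an sl₂-triple of endomorphisms. -/
structure IsSl2 (H X Y : End ℂ V) : Prop where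
  hx : H * X - X * H = X + X
  hy : H * Y - Y * H = -(Y + Y)
  xy : X * Y - Y * X = H

namespace IsSl2

variable {H X Y : End ℂ V}

theorem swap (h : IsSl2 H X Y) : IsSl2 (-H) Y X where
  hx := by linear_combination (norm := noncomm_ring) -h.hy
  hy := by linear_combination (norm := noncomm_ring) -h.hx
  xy := by linear_combination (norm := noncomm_ring) -h.xy

theorem apply_xy (h : IsSl2 H X Y) (v : V) : X (Y v) = Y (X v) + H v := by
  rw [← h.xy]; simp

theorem weight_y (h : IsSl2 H X Y) {c : ℂ} {v : V} (hv : H v = c • v) :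
    H (Y v) = (c - 2) • Y v := by
  have := LinearMap.congr_fun h.hy v
  simp only [LinearMap.sub_apply, Module.End.mul_apply, hv, map_smul, LinearMap.neg_apply,
    LinearMap.add_apply] at this
  linear_combination (norm := module) this

theorem weight_x (h : IsSl2 H X Y) {c : ℂ} {v : V} (hv : H v = c • v) :
    H (X v) = (c + 2) • X v := by
  have := LinearMap.congr_fun h.hx v
  simp only [LinearMap.sub_apply, Module.End.mul_apply, hv, map_smul,
    LinearMap.add_apply] at this
  linear_combination (norm := module) this

theorem weight_y_pow (h : IsSl2 H X Y) {c : ℂ} {v : V} (hv : H v = c • v) (j : ℕ) :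
    H ((Y ^ j) v) = (c - 2 * j) • (Y ^ j) v := by
  induction j with
  | zero => simp [hv]
  | succ j ih =>
    rw [pow_succ', Module.End.mul_apply, h.weight_y ih]
    push_cast
    ring_nf

theorem x_y_pow (h : IsSl2 H X Y) {c : ℂ} {v : V} (hv : H v = c • v) (j : ℕ) :
    X ((Y ^ (j + 1)) v) = (Y ^ (j + 1)) (X v) + ((j + 1) * (c - j)) • (Y ^ j) v := by
  induction j with
  | zero => simp [h.apply_xy, hv]
  | succ j ih =>
    rw [pow_succ', Module.End.mul_apply, h.apply_xy, ih, h.weight_y_pow hv, map_add, map_smul,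
      ← Module.End.mul_apply, ← pow_succ', ← Module.End.mul_apply Y (Y ^ j), ← pow_succ',
      add_assoc, ← add_smul]
    push_cast
    ring_nf

theorem eq_zero_of_y_pow (h : IsSl2 H X Y) {d k : ℕ} {v : V} (hv : H v = (k : ℂ) • v)
    (hX : (X ^ d) v = 0) (hY : (Y ^ k) v = 0) : v = 0 := by
  induction d generalizing k v with
  | zero => simpa using hX
  | succ d ih =>
    have hXv : X v = 0 := by
      refine ih (k := k + 2) ?_ ?_ ?_
      · rw [h.weight_x hv]; push_cast; rfl
      · rwa [← Module.End.mul_apply, ← pow_succ]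
      · have h1 := h.x_y_pow hv k
        rw [pow_succ', Module.End.mul_apply, hY, map_zero, map_zero, sub_self, mul_zero, zero_smul,
          add_zero] at h1
        rw [pow_succ' Y (k + 1), Module.End.mul_apply, pow_succ' Y k, ← h1, map_zero]
    suffices ∀ j ≤ k, (Y ^ j) v = 0 → v = 0 from this k le_rfl hY
    intro j hj hjv
    induction j with
    | zero => simpa using hjv
    | succ j ihj =>
      refine ihj (by omega) ?_
      have h1 := h.x_y_pow hv j
      rw [hjv, hXv, map_zero, map_zero, zero_add, eq_comm, smul_eq_zero] at h1
      refine h1.resolve_left (mul_ne_zero (Nat.cast_add_one_ne_zero j) ?_)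
      rw [sub_ne_zero, Ne, Nat.cast_inj]
      omega

end IsSl2

theorem Submodule.exists_of_injOn [FiniteDimensional ℂ V] {S : Submodule ℂ V} {T : End ℂ V}
    (hT : ∀ v ∈ S, T v ∈ S) (hi : ∀ v ∈ S, T v = 0 → v = 0) {v : V} (hv : v ∈ S) :
    ∃ u ∈ S, T u = v := by
  have : Function.Injective (T.restrict hT) := by
    rw [← LinearMap.ker_eq_bot, LinearMap.ker_eq_bot']
    exact fun x hx => Subtype.ext (hi x x.2 (congrArg Subtype.val hx))
  obtain ⟨u, hu⟩ := LinearMap.injective_iff_surjective.1 this ⟨v, hv⟩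
  exact ⟨u, u.2, congrArg Subtype.val hu⟩

end Sl2

section Exp

variable {V : Type*} [AddCommGroup V] [Module ℂ V] [FiniteDimensional ℂ V] {A B S T R : End ℂ V}

theorem expEnd_eq_sum (hA : IsNilpotent A) {N : ℕ} (hN : finrank ℂ V ≤ N) :
    expEnd A = ∑ k ∈ Finset.range N, ((k.factorial : ℂ))⁻¹ • A ^ k := by
  have key : ∀ M, finrank ℂ V ≤ M → ∑ k ∈ Finset.range M, ((k.factorial : ℂ))⁻¹ • A ^ k =
      ∑ k ∈ Finset.range (finrank ℂ V), ((k.factorial : ℂ))⁻¹ • A ^ k := fun M hM => by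
    refine (Finset.sum_subset (Finset.range_mono hM) fun k _ hk => ?_).symm
    rw [pow_eq_zero_of_le (by simpa using hk) (pow_finrank_eq_zero_of_isNilpotent hA), smul_zero]
  rw [key N hN, ← key _ (Nat.le_succ _)]
  rfl

theorem expEnd_add (hA : IsNilpotent A) (hB : IsNilpotent B) (h : Commute A B) :
    expEnd (A + B) = expEnd A * expEnd B := by
  let : Module ℚ (End ℂ V) := Module.compHom _ (algebraMap ℚ ℂ)
  have key : ∀ {T : End ℂ V}, IsNilpotent T → expEnd T = IsNilpotent.exp T := fun {T} hT => by
    rw [IsNilpotent.exp_eq_sum (pow_finrank_eq_zero_of_isNilpotent hT), expEnd_eq_sum hT le_rfl]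
    refine Finset.sum_congr rfl fun k _ => ?_
    change _ = (algebraMap ℚ ℂ (k.factorial : ℚ)⁻¹) • (T ^ k)
    simp
  rw [key hA, key hB, key (h.isNilpotent_add hA hB), IsNilpotent.exp_add_of_commute h hA hB]

theorem expEnd_zero : expEnd (0 : End ℂ V) = 1 := by
  unfold expEnd
  rw [Finset.sum_range_succ']
  simp

theorem expEnd_mul_neg (hA : IsNilpotent A) : expEnd A * expEnd (-A) = 1 := by
  rw [← expEnd_add hA hA.neg (Commute.refl A).neg_right, add_neg_cancel, expEnd_zero]

theorem expEnd_neg_mul (hA : IsNilpotent A) : expEnd (-A) * expEnd A = 1 := by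
  rw [← expEnd_add hA.neg hA (Commute.refl A).neg_left, neg_add_cancel, expEnd_zero]

theorem IsAdj.expEnd {Q : V →ₗ[ℂ] V →ₛₗ[starRingEnd ℂ] ℂ} (hA : IsAdj Q A A) :
    IsAdj Q (expEnd A) (expEnd A) := by
  intro v w
  unfold _root_.expEnd
  simp only [LinearMap.sum_apply, map_sum, LinearMap.smul_apply, map_smul, map_smulₛₗ]
  refine Finset.sum_congr rfl fun k _ => ?_
  rw [hA.pow k v w]
  simp

theorem expEnd_mem {U : Submodule ℂ V} (hA : ∀ v ∈ U, A v ∈ U) {v : V} (hv : v ∈ U) :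
    expEnd A v ∈ U := by
  unfold expEnd
  rw [LinearMap.sum_apply]
  refine Submodule.sum_mem _ fun k _ => Submodule.smul_mem _ _ ?_
  exact Module.End.pow_apply_mem_of_forall_mem k hA _ hv

theorem expEnd_apply_of_eq_zero {v : V} (hv : A v = 0) : expEnd A v = v := by
  unfold expEnd
  rw [Finset.sum_range_succ', LinearMap.add_apply, LinearMap.sum_apply, Finset.sum_eq_zero]
  · simp
  · intro k _
    rw [LinearMap.smul_apply, pow_succ, Module.End.mul_apply, hv, map_zero, smul_zero]

theorem expEnd_mul_of_bracket (hA : IsNilpotent A) (hT : A * T - T * A = S)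
    (hS : A * S - S * A = R + R) (hR : A * R = R * A) :
    expEnd A * T = (T + S + R) * expEnd A := by
  have hT' : A * T = T * A + S := by rw [← hT]; abel
  have hS' : A * S = S * A + (R + R) := by rw [← hS]; abel
  have hTk : ∀ k : ℕ, A ^ (k + 2) * T = T * A ^ (k + 2) + (k + 2 : ℂ) • (S * A ^ (k + 1)) +
      ((k + 2) * (k + 1) : ℂ) • (R * A ^ k) := by
    intro k
    induction k with
    | zero =>
      have h2 : A ^ 2 * T = T * A ^ 2 + (S * A + S * A) + (R + R) := by
        linear_combination (norm := noncomm_ring) A * hT' + hT' * A + hS'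
      simp only [zero_add, h2, pow_one, pow_zero, mul_one, Nat.cast_zero]
      module
    | succ k ih =>
      rw [show k + 1 + 2 = (k + 2) + 1 from rfl, pow_succ' A (k + 2), mul_assoc, ih, mul_add,
        mul_add, mul_smul_comm, mul_smul_comm, ← mul_assoc A T, ← mul_assoc A S, ← mul_assoc A R,
        hR, hT', hS', add_mul, add_mul, add_mul, mul_assoc T A, mul_assoc S A, mul_assoc R A,
        ← pow_succ' A k, ← pow_succ' A (k + 1), show k + 1 + 1 = k + 2 from rfl]
      push_cast
      module
  have e1 := expEnd_eq_sum hA (le_refl (finrank ℂ V))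
  have e2 := expEnd_eq_sum hA (Nat.le_add_right (finrank ℂ V) 1)
  have e3 := expEnd_eq_sum hA (Nat.le_add_right (finrank ℂ V) 2)
  rw [Finset.sum_range_succ'] at e2
  rw [Finset.sum_range_succ', Finset.sum_range_succ'] at e3
  have e4 : ∀ k : ℕ, (((k + 1 + 1).factorial : ℂ)⁻¹ • A ^ (k + 1 + 1)) * T =
      T * (((k + 1 + 1).factorial : ℂ)⁻¹ • A ^ (k + 1 + 1)) +
      S * (((k + 1).factorial : ℂ)⁻¹ • A ^ (k + 1)) + R * ((k.factorial : ℂ)⁻¹ • A ^ k) := by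
    intro k
    have f0 : (k.factorial : ℂ) ≠ 0 := Nat.cast_ne_zero.2 k.factorial_ne_zero
    have f1 : (k + 1 : ℂ) ≠ 0 := Nat.cast_add_one_ne_zero k
    have f2 : (k + 1 + 1 : ℂ) ≠ 0 := by exact_mod_cast Nat.cast_add_one_ne_zero (R := ℂ) (k + 1)
    have g1 : ((k + 1 + 1).factorial : ℂ)⁻¹ * (k + 2) = ((k + 1).factorial : ℂ)⁻¹ := by
      rw [Nat.factorial_succ (k + 1), Nat.factorial_succ k]
      push_cast
      field_simp
      ring
    have g2 : ((k + 1 + 1).factorial : ℂ)⁻¹ * ((k + 2) * (k + 1)) = (k.factorial : ℂ)⁻¹ := by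
      rw [Nat.factorial_succ (k + 1), Nat.factorial_succ k]
      push_cast
      field_simp
      ring
    rw [smul_mul_assoc, hTk k, mul_smul_comm, mul_smul_comm, mul_smul_comm, smul_add, smul_add,
      smul_smul, smul_smul, g1, g2]
  rw [add_mul, add_mul]
  nth_rw 1 [e3]
  nth_rw 1 [e3]
  nth_rw 1 [e2]
  nth_rw 1 [e1]
  simp only [add_mul, mul_add, Finset.sum_mul, Finset.mul_sum, e4, Finset.sum_add_distrib]
  simp only [zero_add, pow_one, pow_zero, Nat.factorial_zero, Nat.factorial_one, Nat.cast_one,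
    inv_one, one_smul, one_mul, mul_one, hT']
  abel

theorem IsAdj.apply_expEnd {Q : V →ₗ[ℂ] V →ₛₗ[starRingEnd ℂ] ℂ} (hA : IsNilpotent A) {m : ℕ}
    {v : V} (hv : ∀ j, j ≠ m → Q v ((A ^ j) v) = 0) :
    Q v (_root_.expEnd A v) = ((m.factorial : ℂ))⁻¹ * Q v ((A ^ m) v) := by
  rw [expEnd_eq_sum hA (Nat.le_add_right (finrank ℂ V) (m + 1)), LinearMap.sum_apply, map_sum,
    Finset.sum_eq_single m]
  · simp
  · intro j _ hj
    simp [hv j hj]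
  · intro hm
    exact absurd (Finset.mem_range.2 (by omega)) hm

end Exp

section Weil

variable {V : Type*} [AddCommGroup V] [Module ℂ V] [FiniteDimensional ℂ V] {H X Y P : End ℂ V}

theorem weil_eq : weil X Y = expEnd X * expEnd (-Y) * expEnd X := rfl

theorem IsAdj.weil {Q : V →ₗ[ℂ] V →ₛₗ[starRingEnd ℂ] ℂ} (hX : IsAdj Q X X) (hY : IsAdj Q Y Y) :
    IsAdj Q (weil X Y) (weil X Y) := by
  rw [weil_eq]
  have := (hX.expEnd.mul hY.neg.expEnd).mul hX.expEnd
  rwa [← mul_assoc] at this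

/-- An sl₂-triple of endomorphisms together with an operator `P` such that
`[P, X] = X`, `[P, Y] = -Y` and `[P, H] = 0`. -/
structure IsSl2Ext (H X Y P : End ℂ V) : Prop extends IsSl2 H X Y where
  nx : IsNilpotent X
  ny : IsNilpotent Y
  px : P * X - X * P = X
  py : P * Y - Y * P = -Y
  ph : P * H = H * P

namespace IsSl2Ext

theorem expX_mul_y (h : IsSl2Ext H X Y P) : expEnd X * Y = (Y + H + -X) * expEnd X :=
  expEnd_mul_of_bracket h.nx h.xy
    (by linear_combination (norm := noncomm_ring) -h.hx) (by noncomm_ring)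

theorem expX_mul_h (h : IsSl2Ext H X Y P) : expEnd X * H = (H + -(X + X) + 0) * expEnd X :=
  expEnd_mul_of_bracket h.nx (by linear_combination (norm := noncomm_ring) -h.hx)
    (by noncomm_ring) (by simp)

theorem expX_mul_x (h : IsSl2Ext H X Y P) : expEnd X * X = (X + 0 + 0) * expEnd X :=
  expEnd_mul_of_bracket h.nx (by noncomm_ring) (by simp) (by simp)

theorem expX_mul_p (h : IsSl2Ext H X Y P) : expEnd X * P = (P + -X + 0) * expEnd X :=
  expEnd_mul_of_bracket h.nx (by linear_combination (norm := noncomm_ring) -h.px)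
    (by noncomm_ring) (by simp)

theorem expNegY_mul_x (h : IsSl2Ext H X Y P) :
    expEnd (-Y) * X = (X + H + -Y) * expEnd (-Y) :=
  expEnd_mul_of_bracket h.ny.neg (by linear_combination (norm := noncomm_ring) h.xy)
    (by linear_combination (norm := noncomm_ring) h.hy) (by noncomm_ring)

theorem expNegY_mul_h (h : IsSl2Ext H X Y P) :
    expEnd (-Y) * H = (H + -(Y + Y) + 0) * expEnd (-Y) :=
  expEnd_mul_of_bracket h.ny.neg (by linear_combination (norm := noncomm_ring) h.hy)
    (by noncomm_ring) (by simp)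

theorem expNegY_mul_y (h : IsSl2Ext H X Y P) : expEnd (-Y) * Y = (Y + 0 + 0) * expEnd (-Y) :=
  expEnd_mul_of_bracket h.ny.neg (by noncomm_ring) (by simp) (by simp)

theorem expNegY_mul_p (h : IsSl2Ext H X Y P) : expEnd (-Y) * P = (P + -Y + 0) * expEnd (-Y) :=
  expEnd_mul_of_bracket h.ny.neg (by linear_combination (norm := noncomm_ring) h.py)
    (by noncomm_ring) (by simp)

theorem expY_mul_x (h : IsSl2Ext H X Y P) : expEnd Y * X = (X + -H + -Y) * expEnd Y :=
  expEnd_mul_of_bracket h.ny (by linear_combination (norm := noncomm_ring) -h.xy)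
    (by linear_combination (norm := noncomm_ring) h.hy) (by noncomm_ring)

theorem expY_mul_p (h : IsSl2Ext H X Y P) : expEnd Y * P = (P + Y + 0) * expEnd Y :=
  expEnd_mul_of_bracket h.ny (by linear_combination (norm := noncomm_ring) -h.py)
    (by noncomm_ring) (by simp)

theorem weil_mul_y (h : IsSl2Ext H X Y P) : weil X Y * Y = -(X * weil X Y) := by
  rw [weil_eq]
  linear_combination (norm := noncomm_ring) expEnd X * expEnd (-Y) * h.expX_mul_y +
    expEnd X * (h.expNegY_mul_y + h.expNegY_mul_h - h.expNegY_mul_x) * expEnd X -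
    h.expX_mul_x * expEnd (-Y) * expEnd X

theorem weil_mul_x (h : IsSl2Ext H X Y P) : weil X Y * X = -(Y * weil X Y) := by
  rw [weil_eq]
  linear_combination (norm := noncomm_ring) expEnd X * expEnd (-Y) * h.expX_mul_x +
    expEnd X * h.expNegY_mul_x * expEnd X +
    (h.expX_mul_x + h.expX_mul_h - h.expX_mul_y) * expEnd (-Y) * expEnd X

theorem weil_mul_p (h : IsSl2Ext H X Y P) : weil X Y * P = (P - H) * weil X Y := by
  rw [weil_eq]
  linear_combination (norm := noncomm_ring) expEnd X * expEnd (-Y) * h.expX_mul_p +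
    expEnd X * (h.expNegY_mul_p - h.expNegY_mul_x) * expEnd X +
    (h.expX_mul_p - h.expX_mul_x - h.expX_mul_h) * expEnd (-Y) * expEnd X

end IsSl2Ext

end Weil

section Bigrading

variable {V : Type*} [AddCommGroup V] [Module ℂ V]

/-- The bigrading by the joint eigenspaces of `H` and `P`. -/
def bigraded (n : ℤ) (H P : End ℂ V) (i j : ℤ) : Submodule ℂ V :=
  H.eigenspace ((i + j - n : ℤ) : ℂ) ⊓ P.eigenspace (i : ℂ)

theorem mem_bigraded {n : ℤ} {H P : End ℂ V} {i j : ℤ} {v : V} :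
    v ∈ bigraded n H P i j ↔ H v = ((i + j - n : ℤ) : ℂ) • v ∧ P v = (i : ℂ) • v := by
  rw [bigraded, Submodule.mem_inf, End.mem_eigenspace_iff, End.mem_eigenspace_iff]

/-- The filtration defined by a bigrading through the first index. -/
def bigradedFil (n : ℤ) (H P : End ℂ V) (p : ℤ) : Submodule ℂ V :=
  ⨆ (i : ℤ) (_ : p ≤ i) (j : ℤ), bigraded n H P i j

theorem iSupIndep_bigraded (n : ℤ) (H P : End ℂ V) :
    iSupIndep fun ij : ℤ × ℤ => bigraded n H P ij.1 ij.2 := by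
  let c : ℤ × ℤ → ℂ := fun ij => ⟨ij.1, (ij.1 + ij.2 - n : ℤ)⟩
  have hc : Function.Injective c := fun a b hab => by
    have h1 := congrArg Complex.re hab
    have h2 := congrArg Complex.im hab
    simp only [c, Int.cast_inj] at h1 h2
    ext <;> omega
  refine ((P + Complex.I • H).eigenspaces_iSupIndep.comp hc).mono fun ij v hv => ?_
  obtain ⟨h1, h2⟩ := mem_bigraded.1 hv
  rw [Function.comp_apply, End.mem_eigenspace_iff, LinearMap.add_apply, LinearMap.smul_apply, h1,
    h2, smul_smul, ← add_smul]
  congr 1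
  apply Complex.ext <;> simp [c]

variable {n : ℤ} {H X Y P : End ℂ V}

namespace IsSl2Ext

theorem x_mem_bigraded (h : IsSl2Ext H X Y P) {i j : ℤ} {v : V} (hv : v ∈ bigraded n H P i j) :
    X v ∈ bigraded n H P (i + 1) (j + 1) := by
  rw [mem_bigraded] at hv ⊢
  refine ⟨?_, ?_⟩
  · rw [h.weight_x hv.1]
    push_cast
    ring_nf
  · have := LinearMap.congr_fun h.px v
    simp only [LinearMap.sub_apply, Module.End.mul_apply, hv.2, map_smul] at this
    push_cast
    linear_combination (norm := module) this

theorem y_mem_bigraded (h : IsSl2Ext H X Y P) {i j : ℤ} {v : V} (hv : v ∈ bigraded n H P i j) :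
    Y v ∈ bigraded n H P (i - 1) (j - 1) := by
  rw [mem_bigraded] at hv ⊢
  refine ⟨?_, ?_⟩
  · rw [h.weight_y hv.1]
    push_cast
    ring_nf
  · have := LinearMap.congr_fun h.py v
    simp only [LinearMap.sub_apply, Module.End.mul_apply, hv.2, map_smul, LinearMap.neg_apply]
      at this
    push_cast
    linear_combination (norm := module) this

theorem nilpotent_half (h : IsSl2Ext H X Y P) : IsNilpotent ((1 / 2 : ℂ) • X) :=
  h.nx.smul _

variable [FiniteDimensional ℂ V]

theorem mem_iSup_bigraded (h : IsSl2Ext H X Y P) {Vk : ℤ → Submodule ℂ V}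
    (hVk : DirectSum.IsInternal Vk) (hH : ∀ k v, v ∈ Vk k ↔ H v = (k : ℂ) • v) (n : ℤ)
    {q : ℤ} {v : V} (hv : P v = (q : ℂ) • v) : v ∈ ⨆ j, bigraded n H P q j := by
  obtain ⟨π, s, hπ⟩ := hVk.exists_isProjFamily
  have hP : ∀ k, ∀ x ∈ Vk k, P x ∈ Vk k := fun k x hx => by
    rw [hH] at hx ⊢
    rw [← Module.End.mul_apply, ← h.ph, Module.End.mul_apply, hx, map_smul]
  rw [← hπ.sum v]
  refine Submodule.sum_mem _ fun k _ => Submodule.mem_iSup_of_mem (k + n - q) ?_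
  rw [mem_bigraded, show q + (k + n - q) - n = k by ring]
  refine ⟨(hH _ _).1 (hπ.mem k v), ?_⟩
  rw [← hπ.apply_comm hVk hP, hv, map_smul]

theorem exp_half_mul (h : IsSl2Ext H X Y P) :
    expEnd ((1 / 2 : ℂ) • X) * (P + (1 / 2 : ℂ) • X) = P * expEnd ((1 / 2 : ℂ) • X) := by
  have h1 : expEnd ((1 / 2 : ℂ) • X) * P = (P + -((1 / 2 : ℂ) • X) + 0) *
      expEnd ((1 / 2 : ℂ) • X) := by
    refine expEnd_mul_of_bracket h.nilpotent_half ?_ (by simp) (by simp)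
    rw [smul_mul_assoc, mul_smul_comm, ← smul_sub, ← smul_neg, ← neg_sub, h.px]
  have h2 : expEnd ((1 / 2 : ℂ) • X) * ((1 / 2 : ℂ) • X) = ((1 / 2 : ℂ) • X + 0 + 0) *
      expEnd ((1 / 2 : ℂ) • X) :=
    expEnd_mul_of_bracket h.nilpotent_half (by simp) (by simp) (by simp)
  rw [mul_add, h1, h2]
  noncomm_ring

theorem iSup_eigenspace_eq (h : IsSl2Ext H X Y P) {Vk : ℤ → Submodule ℂ V}
    (hVk : DirectSum.IsInternal Vk) (hH : ∀ k v, v ∈ Vk k ↔ H v = (k : ℂ) • v) (n : ℤ) (p : ℤ) :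
    ⨆ (q : ℤ) (_ : p ≤ q), (P + (1 / 2 : ℂ) • X).eigenspace (q : ℂ) = bigradedFil n H P p := by
  have e1 := expEnd_mul_neg h.nilpotent_half
  have e2 := expEnd_neg_mul h.nilpotent_half
  set E := expEnd ((1 / 2 : ℂ) • X) with hE
  set E' := expEnd (-((1 / 2 : ℂ) • X)) with hE'
  have e1' : ∀ v, E (E' v) = v := fun v => LinearMap.congr_fun e1 v
  have e2' : ∀ v, E' (E v) = v := fun v => LinearMap.congr_fun e2 v
  have hex : ∀ v, E ((P + (1 / 2 : ℂ) • X) v) = P (E v) := fun v =>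
    LinearMap.congr_fun h.exp_half_mul v
  refine le_antisymm (iSup₂_le fun q hq x hx => ?_)
    (iSup₂_le fun i hi => iSup_le fun j v hv => ?_)
  · have hst : ∀ v ∈ bigradedFil n H P p, X v ∈ bigradedFil n H P p := by
      suffices bigradedFil n H P p ≤ (bigradedFil n H P p).comap X from this
      refine iSup₂_le fun i hi => iSup_le fun j v hv => ?_
      exact Submodule.mem_iSup_of_mem (i + 1) (Submodule.mem_iSup_of_mem (by omega)
        (Submodule.mem_iSup_of_mem (j + 1) (h.x_mem_bigraded hv)))
    rw [End.mem_eigenspace_iff] at hx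
    have hy : P (E x) = (q : ℂ) • E x := by rw [← hex, hx, map_smul]
    rw [← e2' x]
    refine expEnd_mem (fun v hv => ?_) (Submodule.mem_iSup_of_mem q
      (Submodule.mem_iSup_of_mem hq (h.mem_iSup_bigraded hVk hH n hy)))
    exact neg_mem (Submodule.smul_mem _ _ (hst v hv))
  · set S := ⨆ (q : ℤ) (_ : p ≤ q), (P + (1 / 2 : ℂ) • X).eigenspace (q : ℂ) with hS
    have hst : ∀ v ∈ S, X v ∈ S := by
      suffices S ≤ S.comap X from this
      refine iSup₂_le fun q hq v hv => ?_
      refine Submodule.mem_iSup_of_mem (q + 1) (Submodule.mem_iSup_of_mem (by omega) ?_)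
      rw [End.mem_eigenspace_iff] at hv ⊢
      have := LinearMap.congr_fun h.px v
      simp only [LinearMap.sub_apply, Module.End.mul_apply] at this
      have hv' := congrArg X hv
      simp only [LinearMap.add_apply, LinearMap.smul_apply, map_add, map_smul] at hv' ⊢
      push_cast
      linear_combination (norm := module) this + hv'
    have hv' : E' v ∈ S := by
      refine Submodule.mem_iSup_of_mem i (Submodule.mem_iSup_of_mem hi ?_)
      rw [End.mem_eigenspace_iff, ← e2' ((P + (1 / 2 : ℂ) • X) _), hex, e1',
        (mem_bigraded.1 hv).2, map_smul]
    rw [← e1' v]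
    exact expEnd_mem (fun v hv => Submodule.smul_mem _ _ (hst v hv)) hv'

end IsSl2Ext

end Bigrading

section Polarization

variable {V : Type*} [AddCommGroup V] [Module ℂ V]

theorem IsAdj.apply_eq_zero_of_weight {Q : V →ₗ[ℂ] V →ₛₗ[starRingEnd ℂ] ℂ} {H : End ℂ V}
    (hH : IsAdj Q H (-H)) {a b : ℤ} {v w : V} (hv : H v = (a : ℂ) • v) (hw : H w = (b : ℂ) • w)
    (hab : a + b ≠ 0) : Q v w = 0 := by
  have := hH v w
  simp only [hv, hw, LinearMap.neg_apply, map_neg, map_smul, LinearMap.smul_apply, smul_eq_mul,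
    map_smulₛₗ, map_intCast] at this
  have h1 : ((a + b : ℤ) : ℂ) * Q v w = 0 := by
    push_cast
    linear_combination this
  exact (mul_eq_zero.1 h1).resolve_left (Int.cast_ne_zero.2 hab)

namespace IsSl2

variable {H X Y : End ℂ V}

theorem eq_zero_of_y_pow_x_pow (h : IsSl2 H X Y) (hX : IsNilpotent X) (hY : IsNilpotent Y)
    {m : ℕ} {v : V} (hv : H v = (-m : ℂ) • v) (h0 : (Y ^ m) ((X ^ m) v) = 0) : v = 0 := by
  obtain ⟨d, hd⟩ := hX
  obtain ⟨e, he⟩ := hY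
  have hv' : (-H) v = (m : ℂ) • v := by rw [LinearMap.neg_apply, hv, neg_smul, neg_neg]
  have hXv : H ((X ^ m) v) = (m : ℂ) • (X ^ m) v := by
    have := h.swap.weight_y_pow hv' m
    rw [LinearMap.neg_apply] at this
    linear_combination (norm := module) -this
  exact h.swap.eq_zero_of_y_pow hv' (d := e) (by rw [he]; rfl)
    (h.eq_zero_of_y_pow hXv (d := d) (by rw [hd]; rfl) h0)

theorem y_pow_eq_zero (h : IsSl2 H X Y) (hY : IsNilpotent Y) {k : ℕ} {p : V}
    (hp : H p = (k : ℂ) • p) (hX : X p = 0) {a : ℕ} (ha : k < a) : (Y ^ a) p = 0 := by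
  obtain ⟨e, he⟩ := hY
  suffices (Y ^ (k + 1)) p = 0 by
    rw [← Nat.sub_add_cancel (Nat.succ_le_of_lt ha), pow_add, Module.End.mul_apply, this, map_zero]
  have hw := h.weight_y_pow hp (k + 1)
  refine h.swap.eq_zero_of_y_pow (k := k + 2) (d := e) ?_ (by rw [he]; rfl) ?_
  · rw [LinearMap.neg_apply, hw]
    push_cast
    module
  · rw [pow_succ, Module.End.mul_apply, h.x_y_pow hp, hX]
    simp

theorem x_pow_y_pow (h : IsSl2 H X Y) {c : ℂ} {p : V} (hp : H p = c • p) (hX : X p = 0) (a : ℕ) :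
    (X ^ (a + 1)) ((Y ^ a) p) = 0 := by
  induction a with
  | zero => simpa using hX
  | succ a ih =>
    rw [pow_succ, Module.End.mul_apply, h.x_y_pow hp, hX, map_zero, zero_add, map_smul, ih,
      smul_zero]

end IsSl2

variable [FiniteDimensional ℂ V]

/-- An extended sl₂-triple acting compatibly with a hermitian pairing `Q`, which is positive on
the joint Hodge structure of weight `n`. -/
structure IsPolarizedSl2 (n : ℤ) (Q : V →ₗ[ℂ] V →ₛₗ[starRingEnd ℂ] ℂ) (H X Y P : End ℂ V) :
    Prop extends IsSl2Ext H X Y P where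
  herm : ∀ v w : V, Q w v = starRingEnd ℂ (Q v w)
  adj_h : IsAdj Q H (-H)
  adj_x : IsAdj Q X X
  adj_y : IsAdj Q Y Y
  adj_p : IsAdj Q P (P - H)
  inj : ∀ k : ℤ, 0 < k → ∀ u, H u = (k : ℂ) • u → X (Y u) = 0 → u = 0
  pos : ∀ (i : ℤ) (v : V), v ≠ 0 → (P + (1 / 2 : ℂ) • X) v = (i : ℂ) • v →
    0 < ((-1 : ℂ) ^ (n - i) * Q (expEnd Y v) (expEnd Y v)).re

namespace IsPolarizedSl2

variable {n : ℤ} {Q : V →ₗ[ℂ] V →ₛₗ[starRingEnd ℂ] ℂ} {H X Y P : End ℂ V}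

theorem weil_y_pow (h : IsPolarizedSl2 n Q H X Y P) (a : ℕ) (v : V) :
    weil X Y ((Y ^ a) v) = (-1 : ℂ) ^ a • (X ^ a) (weil X Y v) := by
  induction a generalizing v with
  | zero => simp
  | succ a ih =>
    have := LinearMap.congr_fun h.weil_mul_y v
    rw [Module.End.mul_apply, LinearMap.neg_apply, Module.End.mul_apply] at this
    rw [pow_succ, Module.End.mul_apply, ih, this, map_neg, pow_succ X, Module.End.mul_apply,
      pow_succ, mul_smul, neg_smul, one_smul]

theorem weil_orthogonal (h : IsPolarizedSl2 n Q H X Y P) {i j i' j' : ℤ} (hi : i ≠ i') {v v' : V}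
    (hv : v ∈ bigraded n H P i j) (hv' : v' ∈ bigraded n H P i' j') :
    Q v (weil X Y v') = 0 := by
  have h1 := LinearMap.congr_fun h.weil_mul_p v'
  rw [Module.End.mul_apply, Module.End.mul_apply, (mem_bigraded.1 hv').2, map_smul] at h1
  have h2 := h.adj_p v (weil X Y v')
  rw [← h1, (mem_bigraded.1 hv).2, map_smul, map_smulₛₗ, LinearMap.smul_apply, smul_eq_mul,
    smul_eq_mul, map_intCast, ← sub_eq_zero, ← sub_mul] at h2
  exact (mul_eq_zero.1 h2).resolve_left (sub_ne_zero.2 (Int.cast_injective.ne hi))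

theorem weil_im (h : IsPolarizedSl2 n Q H X Y P) (j : ℤ) (v : V) :
    ((-1 : ℂ) ^ j * Q v (weil X Y v)).im = 0 := by
  rw [← Complex.conj_eq_iff_im, map_mul, map_zpow₀, ← h.herm, h.adj_x.weil h.adj_y]
  simp

theorem weil_pos_of_primitive (h : IsPolarizedSl2 n Q H X Y P) {i j : ℤ} {k : ℕ}
    (hk : i + j - n = k) {p : V} (hp : p ∈ bigraded n H P i j) (hX : X p = 0) (h0 : p ≠ 0) :
    0 < ((-1 : ℂ) ^ j * Q p (weil X Y p)).re := by
  rw [mem_bigraded, hk] at hp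
  have hvan : ∀ l, l ≠ k → Q p ((Y ^ l) p) = 0 := fun l hl => by
    refine h.adj_h.apply_eq_zero_of_weight (a := k) (b := k - 2 * l) hp.1 ?_ (by omega)
    rw [h.weight_y_pow hp.1]
    push_cast
    rfl
  have h2 : ∀ l, ((Y + Y) ^ l) p = (2 : ℂ) ^ l • (Y ^ l) p := fun l => by
    rw [← two_smul ℂ Y, smul_pow, LinearMap.smul_apply]
  have h3 : ∀ l, ((-Y) ^ l) p = (-1 : ℂ) ^ l • (Y ^ l) p := fun l => by
    rw [← neg_one_smul ℂ Y, smul_pow, LinearMap.smul_apply]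
  have e1 : Q (expEnd Y p) (expEnd Y p) = ((k.factorial : ℂ))⁻¹ * (2 ^ k * Q p ((Y ^ k) p)) := by
    rw [h.adj_y.expEnd, ← Module.End.mul_apply, ← expEnd_add h.ny h.ny (Commute.refl Y),
      IsAdj.apply_expEnd ((Commute.refl Y).isNilpotent_add h.ny h.ny) (m := k), h2]
    · simp [map_ofNat]
    · intro l hl
      simp [h2, hvan l hl]
  have e2 : Q p (weil X Y p) = ((k.factorial : ℂ))⁻¹ * ((-1) ^ k * Q p ((Y ^ k) p)) := by
    rw [weil_eq, Module.End.mul_apply, Module.End.mul_apply, ← h.adj_x.expEnd,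
      expEnd_apply_of_eq_zero hX, IsAdj.apply_expEnd h.ny.neg (m := k), h3]
    · simp
    · intro l hl
      simp [h3, hvan l hl]
  have hpos := h.pos i p h0 (by simp [hX, hp.2])
  have hs : (-1 : ℂ) ^ (n - i) = (-1) ^ j * (-1) ^ k := by
    rw [show n - i = j + k - 2 * k by omega, zpow_sub₀ (by norm_num), zpow_add₀ (by norm_num),
      zpow_mul]
    simp
  have e3 : (-1 : ℂ) ^ (n - i) * Q (expEnd Y p) (expEnd Y p) =
      ((2 ^ k : ℝ) : ℂ) * ((-1 : ℂ) ^ j * Q p (weil X Y p)) := by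
    rw [e1, e2, hs]
    push_cast
    ring
  rw [e3, Complex.re_ofReal_mul] at hpos
  exact pos_of_mul_pos_right hpos (by positivity)

theorem weil_pos_of_y_pow_primitive (h : IsPolarizedSl2 n Q H X Y P) {i j : ℤ} {k : ℕ}
    (hk : i + j - n = k) {p : V} (hp : p ∈ bigraded n H P i j) (hX : X p = 0) (a : ℕ)
    (h0 : (Y ^ a) p ≠ 0) :
    0 < ((-1 : ℂ) ^ (j - a) * Q ((Y ^ a) p) (weil X Y ((Y ^ a) p))).re := by
  have hw : H p = (k : ℂ) • p := by
    have := (mem_bigraded.1 hp).1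
    rwa [hk] at this
  induction a with
  | zero => simpa using h.weil_pos_of_primitive hk hp hX (by simpa using h0)
  | succ a ih =>
    have hak : a < k := by
      by_contra hak
      exact h0 (h.y_pow_eq_zero h.ny hw hX (by omega))
    have ih' := ih fun h1 => h0 (by rw [pow_succ', Module.End.mul_apply, h1, map_zero])
    have e1 : Y (weil X Y ((Y ^ (a + 1)) p)) =
        -(((a + 1) * (k - a) : ℝ) : ℂ) • weil X Y ((Y ^ a) p) := by
      have := LinearMap.congr_fun h.weil_mul_x ((Y ^ (a + 1)) p)
      rw [Module.End.mul_apply, LinearMap.neg_apply, Module.End.mul_apply, h.x_y_pow hw, hX,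
        map_zero, zero_add, map_smul] at this
      push_cast
      linear_combination (norm := module) this
    have e2 : (-1 : ℂ) ^ (j - (a + 1 : ℕ)) * Q ((Y ^ (a + 1)) p) (weil X Y ((Y ^ (a + 1)) p)) =
        (((a + 1) * (k - a) : ℝ) : ℂ) *
          ((-1 : ℂ) ^ (j - a) * Q ((Y ^ a) p) (weil X Y ((Y ^ a) p))) := by
      have hs : (-1 : ℂ) ^ (j - (a + 1 : ℕ)) = -(-1) ^ (j - a) := by
        rw [show j - (a + 1 : ℕ) = j - a - 1 by push_cast; ring, zpow_sub_one₀ (by norm_num)]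
        norm_num
      have e3 : Q ((Y ^ (a + 1)) p) (weil X Y ((Y ^ (a + 1)) p)) =
          -(((a + 1) * (k - a) : ℝ) : ℂ) * Q ((Y ^ a) p) (weil X Y ((Y ^ a) p)) := by
        have e0 := h.adj_y ((Y ^ a) p) (weil X Y ((Y ^ (a + 1)) p))
        rwa [e1, ← Module.End.mul_apply Y (Y ^ a), ← pow_succ', map_smulₛₗ, map_neg,
          Complex.conj_ofReal, smul_eq_mul] at e0
      rw [hs, e3]
      ring
    rw [e2, Complex.re_ofReal_mul]
    have : (a : ℝ) < k := Nat.cast_lt.2 hak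
    exact mul_pos (mul_pos (by positivity) (by linarith)) ih'

theorem weil_pos_of_y_pow (h : IsPolarizedSl2 n Q H X Y P) {i j : ℤ} {k : ℕ}
    (hk : i + j - n = k) {u : V} (hu : u ∈ bigraded n H P i j) (a : ℕ) (h0 : (Y ^ a) u ≠ 0) :
    0 < ((-1 : ℂ) ^ (j - a) * Q ((Y ^ a) u) (weil X Y ((Y ^ a) u))).re := by
  obtain ⟨N, hN⟩ := h.ny
  obtain ⟨d, hd⟩ := h.nx
  suffices ∀ M k : ℕ, N ≤ k + M → ∀ i j : ℤ, i + j - n = k → ∀ u ∈ bigraded n H P i j, ∀ a : ℕ,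
      (Y ^ a) u ≠ 0 → 0 < ((-1 : ℂ) ^ (j - a) * Q ((Y ^ a) u) (weil X Y ((Y ^ a) u))).re from
    this N k (by omega) i j hk u hu a h0
  intro M
  induction M with
  | zero =>
    intro k hNk i j hk u hu a h0
    have hw := (mem_bigraded.1 hu).1
    rw [hk] at hw
    have := h.eq_zero_of_y_pow (d := d) (k := k) hw (by rw [hd]; rfl)
      (by rw [pow_eq_zero_of_le (by omega) hN]; rfl)
    exact absurd (by rw [this, map_zero]) h0
  | succ M ih =>
    intro k hNk i j hk u hu a h0
    obtain ⟨u', hu', hXY⟩ := Submodule.exists_of_injOn (S := bigraded n H P (i + 1) (j + 1))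
      (T := X * Y) (fun v hv => by simpa using h.x_mem_bigraded (h.y_mem_bigraded hv))
      (fun v hv hv0 => h.inj (i + 1 + (j + 1) - n) (by omega) v (mem_bigraded.1 hv).1 hv0)
      (h.x_mem_bigraded hu)
    have hYu' : Y u' ∈ bigraded n H P i j := by simpa using h.y_mem_bigraded hu'
    set p := u - Y u' with hp
    have hpm : p ∈ bigraded n H P i j := sub_mem hu hYu'
    have hXp : X p = 0 := by rw [hp, map_sub, ← hXY, Module.End.mul_apply, sub_self]
    have hsum : (Y ^ a) u = (Y ^ a) p + (Y ^ (a + 1)) u' := by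
      rw [hp, map_sub, pow_succ, Module.End.mul_apply, sub_add_cancel]
    have hcross : Q ((Y ^ a) p) (weil X Y ((Y ^ (a + 1)) u')) = 0 := by
      rw [h.weil_y_pow, map_smulₛₗ, ← h.adj_x.pow,
        h.x_pow_y_pow (mem_bigraded.1 hpm).1 hXp]
      simp
    have hcross' : Q ((Y ^ (a + 1)) u') (weil X Y ((Y ^ a) p)) = 0 := by
      rw [← h.adj_x.weil h.adj_y, h.herm, hcross, map_zero]
    have hA : 0 ≤ ((-1 : ℂ) ^ (j - a) * Q ((Y ^ a) p) (weil X Y ((Y ^ a) p))).re ∧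
        ((Y ^ a) p ≠ 0 → 0 < ((-1 : ℂ) ^ (j - a) * Q ((Y ^ a) p) (weil X Y ((Y ^ a) p))).re) := by
      have := h.weil_pos_of_y_pow_primitive hk hpm hXp a
      rcases eq_or_ne ((Y ^ a) p) 0 with h1 | h1
      · simp [h1]
      · exact ⟨(this h1).le, this⟩
    have hB : 0 ≤ ((-1 : ℂ) ^ (j - a) *
          Q ((Y ^ (a + 1)) u') (weil X Y ((Y ^ (a + 1)) u'))).re ∧
        ((Y ^ (a + 1)) u' ≠ 0 → 0 < ((-1 : ℂ) ^ (j - a) *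
          Q ((Y ^ (a + 1)) u') (weil X Y ((Y ^ (a + 1)) u'))).re) := by
      have := ih (k + 2) (by omega) (i + 1) (j + 1) (by push_cast; omega) u' hu' (a + 1)
      rw [show j + 1 - (a + 1 : ℕ) = j - a by push_cast; ring] at this
      rcases eq_or_ne ((Y ^ (a + 1)) u') 0 with h1 | h1
      · simp [h1]
      · exact ⟨(this h1).le, this⟩
    have e : Q ((Y ^ a) u) (weil X Y ((Y ^ a) u)) = Q ((Y ^ a) p) (weil X Y ((Y ^ a) p)) +
        Q ((Y ^ (a + 1)) u') (weil X Y ((Y ^ (a + 1)) u')) := by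
      rw [hsum]
      simp only [map_add, LinearMap.add_apply, hcross, hcross', add_zero, zero_add]
    rw [e, mul_add, Complex.add_re]
    rcases eq_or_ne ((Y ^ a) p) 0 with h1 | h1
    · have h2 : (Y ^ (a + 1)) u' ≠ 0 := fun h2 => h0 (by rw [hsum, h1, h2, add_zero])
      linarith [hA.1, hB.2 h2]
    · linarith [hA.2 h1, hB.1]

theorem weil_pos (h : IsPolarizedSl2 n Q H X Y P) {i j : ℤ} {v : V}
    (hv : v ∈ bigraded n H P i j) (h0 : v ≠ 0) : posC ((-1 : ℂ) ^ j * Q v (weil X Y v)) := by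
  refine ⟨h.weil_im j v, ?_⟩
  rcases le_or_gt 0 (i + j - n) with hk | hk
  · obtain ⟨k, hk⟩ := Int.eq_ofNat_of_zero_le hk
    simpa using h.weil_pos_of_y_pow hk hv 0 (by simpa using h0)
  · obtain ⟨m, hm⟩ := Int.eq_ofNat_of_zero_le (show 0 ≤ -(i + j - n) by omega)
    have hX : ∀ l : ℕ, ∀ v ∈ bigraded n H P i j,
        (X ^ l) v ∈ bigraded n H P (i + l) (j + l) := by
      intro l v hv
      induction l with
      | zero => simpa using hv
      | succ l ih =>
        rw [pow_succ', Module.End.mul_apply]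
        push_cast
        rw [← add_assoc, ← add_assoc]
        exact h.x_mem_bigraded ih
    have hY : ∀ (l : ℕ) (i j : ℤ), ∀ v ∈ bigraded n H P i j,
        (Y ^ l) v ∈ bigraded n H P (i - l) (j - l) := by
      intro l i j v hv
      induction l with
      | zero => simpa using hv
      | succ l ih =>
        rw [pow_succ', Module.End.mul_apply]
        push_cast
        rw [← sub_sub, ← sub_sub]
        exact h.y_mem_bigraded ih
    obtain ⟨u, hu, rfl⟩ := Submodule.exists_of_injOn (S := bigraded n H P i j)
      (T := Y ^ m * X ^ m)
      (fun v hv => by simpa using hY m _ _ _ (hX m v hv))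
      (fun v hv hv0 => h.eq_zero_of_y_pow_x_pow h.nx h.ny (m := m) (by
        rw [(mem_bigraded.1 hv).1, show i + j - n = -m by omega]
        push_cast
        rfl) hv0) hv
    have := h.weil_pos_of_y_pow (k := m) (by omega) (hX m u hu) m h0
    simpa using this

end IsPolarizedSl2

end Polarization

section Main

variable {V : Type*} [AddCommGroup V] [Module ℂ V] [FiniteDimensional ℂ V] {H X Y P D : End ℂ V}

theorem IsSl2Ext.mul_expY (h : IsSl2Ext H X Y P) (hD : D + D = P + P - H + X + Y) :
    D * expEnd Y = expEnd Y * (P + (1 / 2 : ℂ) • X) := by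
  have h1 : (D + D) * expEnd Y = expEnd Y * (P + P + X) := by
    rw [hD]
    linear_combination (norm := noncomm_ring) -2 * h.expY_mul_p - h.expY_mul_x
  have h2 : (2 : ℂ) • (D * expEnd Y) = (2 : ℂ) • (expEnd Y * (P + (1 / 2 : ℂ) • X)) := by
    rw [two_smul, ← add_mul, h1, mul_add, mul_add, mul_add, mul_smul_comm]
    module
  exact smul_right_injective _ two_ne_zero h2

theorem IsPolarizedHodge.exists_polarizedSl2 {n : ℤ} {Q : V →ₗ[ℂ] V →ₛₗ[starRingEnd ℂ] ℂ}
    {F : ℤ → Submodule ℂ V}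
    (hW : IsPolarizedHodge n Q (fun p => (F p).map (expEnd Y)) (hodgePiece Y F Q))
    (hH : ∀ T : End ℂ V, (∀ (k : ℤ) v, H v = (k : ℂ) • v → T v = 0) → T = 0)
    (hY : IsNilpotent Y) (hHY : H * Y - Y * H = -(Y + Y))
    (hQH : IsAdj Q H (-H)) (hQY : IsAdj Q Y Y)
    (hYF : ∀ p, (F p).map Y ≤ F (p - 1)) (hHF : ∀ p, (F p).map H ≤ F p) :
    ∃ X P : End ℂ V, IsPolarizedSl2 n Q H X Y P ∧
      (⨆ q : ℤ, (P + (1 / 2 : ℂ) • X).eigenspace (q : ℂ)) = ⊤ ∧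
      ∀ p, F p = ⨆ (q : ℤ) (_ : p ≤ q), (P + (1 / 2 : ℂ) • X).eigenspace (q : ℂ) := by
  have hYe : expEnd Y * Y = (Y + 0 + 0) * expEnd Y :=
    expEnd_mul_of_bracket hY (by noncomm_ring) (by simp) (by simp)
  have hHe : expEnd Y * H = (H + (Y + Y) + 0) * expEnd Y :=
    expEnd_mul_of_bracket hY (by linear_combination (norm := noncomm_ring) -hHY)
      (by noncomm_ring) (by simp)
  simp only [add_zero] at hYe hHe
  obtain ⟨X, P, D, nX, HX, XY, PX, PY, PH, hD, QX, QP, hU, inj⟩ := hW.exists_sl2 hH hY hHY hQH hQY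
    (fun p x hx => by
      obtain ⟨f, hf, rfl⟩ := hx
      exact ⟨Y f, hYF p ⟨f, hf, rfl⟩, LinearMap.congr_fun hYe f⟩)
    (fun p x hx => by
      obtain ⟨f, hf, rfl⟩ := hx
      exact ⟨H f, hHF p ⟨f, hf, rfl⟩, LinearMap.congr_fun hHe f⟩)
  have hext : IsSl2Ext H X Y P :=
    { hx := HX, hy := hHY, xy := XY, nx := nX, ny := hY, px := PX, py := PY, ph := PH }
  have hinv : ∀ v, expEnd (-Y) (expEnd Y v) = v := LinearMap.congr_fun (expEnd_neg_mul hY)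
  have hinj : Function.Injective (expEnd Y) := Function.LeftInverse.injective hinv
  have hinv' : ∀ v, expEnd Y (expEnd (-Y) v) = v := LinearMap.congr_fun (expEnd_mul_neg hY)
  have hmem : ∀ q v, v ∈ (P + (1 / 2 : ℂ) • X).eigenspace ((q : ℤ) : ℂ) ↔
      expEnd Y v ∈ hodgePiece Y F Q q := fun q v => by
    have := LinearMap.congr_fun (hext.mul_expY hD) v
    rw [Module.End.mul_apply, Module.End.mul_apply] at this
    rw [hU, this, ← map_smul, hinj.eq_iff, End.mem_eigenspace_iff]
  have hmap : ∀ q : ℤ, (hodgePiece Y F Q q).map (expEnd (-Y)) =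
      (P + (1 / 2 : ℂ) • X).eigenspace (q : ℂ) := fun q => by
    ext v
    rw [hmem]
    refine ⟨?_, fun hv => ⟨_, hv, hinv v⟩⟩
    rintro ⟨u, hu, rfl⟩
    rwa [hinv']
  refine ⟨X, P, ⟨hext, hW.herm, hQH, QX, hQY, QP, inj, fun i v hv hvi => ?_⟩, ?_, fun p => ?_⟩
  · exact (hW.pos i _ ((hmem i v).1 (End.mem_eigenspace_iff.2 hvi))
      (fun h0 => hv (hinj (by rw [h0, map_zero])))).2
  · simp_rw [← hmap, ← Submodule.map_iSup, hW.internal.submodule_iSup_eq_top]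
    rw [Submodule.map_top, LinearMap.range_eq_top]
    exact Function.LeftInverse.surjective hinv
  · simp_rw [← hmap, ← Submodule.map_iSup]
    rw [← hW.eq_iSup, ← Submodule.map_comp]
    have : expEnd (-Y) ∘ₗ expEnd Y = LinearMap.id := expEnd_neg_mul hY
    rw [this, Submodule.map_id]

end Main

theorem graded_polarized_filtration_gives_sl2
    {V : Type*} [AddCommGroup V] [Module ℂ V] [FiniteDimensional ℂ V]
    (n : ℤ)
    -- the grading `V = ⊕_k V_k`, and `H` acting as `k` on `V_k`
    (Vk : ℤ → Submodule ℂ V) (hVk : DirectSum.IsInternal Vk)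
    (H : V →ₗ[ℂ] V) (hH : ∀ k : ℤ, ∀ v ∈ Vk k, H v = ((k : ℤ) : ℂ) • v)
    -- the nilpotent `Y` with `[H, Y] = −2Y`
    (Y : V →ₗ[ℂ] V) (hYnil : IsNilpotent Y)
    (hHY : H ∘ₗ Y - Y ∘ₗ H = (-2 : ℂ) • Y)
    -- the hermitian pairing `Q` with `H† = −H`, `Y† = Y`
    (Q : V →ₗ[ℂ] V →ₛₗ[starRingEnd ℂ] ℂ)
    (hherm : ∀ v w : V, Q w v = starRingEnd ℂ (Q v w))
    (hnd : ∀ v : V, (∀ w : V, Q v w = 0) → v = 0)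
    (hQH : ∀ v w : V, Q (H v) w = -Q v (H w))
    (hQY : ∀ v w : V, Q (Y v) w = Q v (Y w))
    -- the filtration `F`
    (F : ℤ → Submodule ℂ V) (hFanti : Antitone F)
    (hYF : ∀ p : ℤ, Submodule.map Y (F p) ≤ F (p - 1))
    (hHF : ∀ p : ℤ, Submodule.map H (F p) = F p)
    -- `e^Y F` is the Hodge filtration of a weight-`n` Hodge structure polarized by `Q`
    (hInt : DirectSum.IsInternal (fun p : ℤ => hodgePiece Y F Q p))
    (horth : ∀ p p' : ℤ, p ≠ p' →
      ∀ v ∈ hodgePiece Y F Q p, ∀ w ∈ hodgePiece Y F Q p', Q v w = 0)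
    (hpos : ∀ p : ℤ, ∀ v ∈ hodgePiece Y F Q p, v ≠ 0 →
      posC ((-1 : ℂ) ^ (n - p) * Q v v)) :
    -- `Y^k : V_k → V_{−k}` is an isomorphism for every `k ≥ 0`,
    (∀ k : ℕ, Submodule.map (Y ^ k) (Vk (k : ℤ)) = Vk (-(k : ℤ)) ∧
      ∀ v ∈ Vk (k : ℤ), (Y ^ k) v = 0 → v = 0) ∧
    -- and there are `X` and a bigrading making `(V, H, X, Y)` an sl₂-Hodge structure
    -- of weight `n` with total Hodge filtration `F`, polarized by `Q`.
    (∃ X : V →ₗ[ℂ] V,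
      H ∘ₗ X - X ∘ₗ H = (2 : ℂ) • X ∧
      X ∘ₗ Y - Y ∘ₗ X = H ∧
      ∃ Vb : ℤ → ℤ → Submodule ℂ V,
        IsSl2HodgeBigrading n H X Y F Vb ∧
        (∀ i j i' j' : ℤ, i + j = i' + j' → (i, j) ≠ (i', j') →
          ∀ v ∈ Vb i j, ∀ v' ∈ Vb i' j', Q v (weil X Y v') = 0) ∧
        (∀ i j : ℤ, ∀ v ∈ Vb i j, v ≠ 0 → posC ((-1 : ℂ) ^ j * Q v (weil X Y v)))) := by
  have hmem := hVk.mem_iff_of_grading hH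
  have hHY' : H * Y - Y * H = -(Y + Y) := by
    rw [← two_smul ℂ, ← neg_smul]
    exact hHY
  have hW : IsPolarizedHodge n Q (fun p => (F p).map (expEnd Y)) (hodgePiece Y F Q) :=
    ⟨hherm, fun p q hpq => Submodule.map_mono (hFanti hpq), fun _ => rfl, hInt, horth, hpos⟩
  obtain ⟨X, P, h, htop, hF⟩ := hW.exists_polarizedSl2
    (fun T hT => hVk.end_ext fun k v hv => by simpa using hT k v (hH k v hv)) hYnil hHY'
    (fun v w => by simp [hQH v w]) hQY hYF fun p => (hHF p).le
  have hfil := h.iSup_eigenspace_eq hVk hmem n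
  refine ⟨fun k => ⟨le_antisymm ?_ fun v hv => ?_, fun v hv hv0 => ?_⟩, X, ?_, h.xy,
    bigraded n H P, ⟨?_, fun i j v hv => (mem_bigraded.1 hv).1, fun i j => ?_, fun i j => ?_,
      fun p => (hF p).trans (hfil p)⟩, fun i j i' j' hij hne v hv v' hv' => ?_,
    fun i j v hv hv0 => h.weil_pos hv hv0⟩
  · rintro _ ⟨v, hv, rfl⟩
    rw [hmem, h.weight_y_pow (hH _ v hv)]
    push_cast
    module
  · have hX : ∀ v ∈ Vk (-(k : ℤ)), H ((X ^ k) v) = (k : ℂ) • (X ^ k) v := fun v hv => by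
      have := h.swap.weight_y_pow (c := k) (v := v) (by simp [hH _ v hv]) k
      rw [LinearMap.neg_apply, neg_eq_iff_eq_neg] at this
      rw [this]
      module
    have hT : ∀ v ∈ Vk (-(k : ℤ)), (Y ^ k * X ^ k) v ∈ Vk (-(k : ℤ)) := fun v hv =>
      (hmem _ _).2 <| by
        rw [Module.End.mul_apply, h.weight_y_pow (hX v hv)]
        push_cast
        module
    have hi : ∀ v ∈ Vk (-(k : ℤ)), (Y ^ k * X ^ k) v = 0 → v = 0 := fun v hv hv0 =>
      h.eq_zero_of_y_pow_x_pow h.nx h.ny (m := k) (by simpa using hH _ v hv) hv0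
    obtain ⟨u, hu, rfl⟩ := Submodule.exists_of_injOn hT hi hv
    exact ⟨(X ^ k) u, (hmem _ _).2 (by simpa using hX u hu), rfl⟩
  · obtain ⟨d, hd⟩ := h.nx
    exact h.eq_zero_of_y_pow (d := d) (by simpa using hH _ v hv) (by rw [hd]; rfl) hv0
  · rw [two_smul]
    exact h.hx
  · refine DirectSum.isInternal_submodule_of_iSupIndep_of_iSup_eq_top
      (iSupIndep_bigraded n H P) (eq_top_iff.2 ?_)
    rw [← htop]
    refine iSup_le fun q => ((le_iSup₂_of_le q le_rfl le_rfl).trans (hfil q).le).trans ?_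
    exact iSup₂_le fun i _ => iSup_le fun j =>
      le_iSup (fun ij : ℤ × ℤ => bigraded n H P ij.1 ij.2) (i, j)
  · rintro _ ⟨v, hv, rfl⟩
    exact h.x_mem_bigraded hv
  · rintro _ ⟨v, hv, rfl⟩
    exact h.y_mem_bigraded hv
  · refine h.weil_orthogonal (fun hi => hne ?_) hv hv'
    subst hi
    simpa using hij
end

section
/- Let (W_•, F^•, F̄^•) be a mixed Hodge structure on a finite-dimensional complex vector space V. Then there exists a unique splitting H of the weight filtration W_• such that H belongs to F⁰End(V) ∩ W₀End(V) ∩ ( F̄⁰End(V) ∩ W₀End(V) + Σ_{k≥1} ( F̄^{−k}End(V) ∩ W_{−k−1}End(V) ) ), where the filtrations on End(V) are the induced ones. Moreover, this splitting satisfies: if v ∈ F^p ∩ W_{p+q} ∩ F̄^q, then Hv = (p+q)·v. -/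
/-!
Deligne's splitting of a mixed Hodge structure: there is a unique splitting `H` of the
weight filtration with
`H ∈ F⁰End(V) ∩ W₀End(V) ∩ (F̄⁰End(V) ∩ W₀End(V) + Σ_{k≥1}(F̄^{−k}End(V) ∩ W_{−k−1}End(V)))`,
and it satisfies `Hv = (p+q)v` for `v ∈ F^p ∩ W_{p+q} ∩ F̄^q`.
-/

/-- The image of `A ∩ W n` in the quotient `V ⧸ W (n−1)`. -/
def grPiece {V : Type*} [AddCommGroup V] [Module ℂ V]
    (W : ℤ → Submodule ℂ V) (n : ℤ) (A : Submodule ℂ V) :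
    Submodule ℂ (V ⧸ W (n - 1)) :=
  Submodule.map (W (n - 1)).mkQ (A ⊓ W n)

/-- `(W, F, F̄)` is a mixed Hodge structure on `V`: `W` is increasing and exhaustive,
`F`, `F̄` are decreasing, and each graded quotient `gr_n^W` is the direct sum of its
pieces `F^p gr_n^W ∩ F̄^q gr_n^W`, `p + q = n`. -/
def IsMHS {V : Type*} [AddCommGroup V] [Module ℂ V]
    (W F Fb : ℤ → Submodule ℂ V) : Prop :=
  Monotone W ∧ Antitone F ∧ Antitone Fb ∧
  (∃ a : ℤ, W a = ⊥) ∧ (∃ b : ℤ, W b = ⊤) ∧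
  ∀ n : ℤ,
    (Submodule.map (W (n - 1)).mkQ (W n) =
      ⨆ p : ℤ, grPiece W n (F p) ⊓ grPiece W n (Fb (n - p))) ∧
    iSupIndep (fun p : ℤ => grPiece W n (F p) ⊓ grPiece W n (Fb (n - p)))

/-- The induced filtration on `End(V)`: endomorphisms shifting the filtration `G`
by `k` steps, i.e. `A (G n) ⊆ G (n + k)` for all `n`. -/
def shiftEnd {V : Type*} [AddCommGroup V] [Module ℂ V]
    (G : ℤ → Submodule ℂ V) (k : ℤ) : Submodule ℂ (V →ₗ[ℂ] V) where
  carrier := {A | ∀ n : ℤ, ∀ v ∈ G n, A v ∈ G (n + k)}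
  add_mem' {A B} hA hB := by
    intro m v hv
    simpa using (G (m + k)).add_mem (hA m v hv) (hB m v hv)
  zero_mem' := by intro m v hv; simp
  smul_mem' c A hA := by
    intro m v hv
    simpa using (G (m + k)).smul_mem c (hA m v hv)

/-- `H` is a splitting of the weight filtration `W`: `H` is diagonalizable with integer
eigenvalues and `W n = E_n(H) ⊕ W (n−1)` for every `n`. -/
def IsWeightSplitting {V : Type*} [AddCommGroup V] [Module ℂ V]
    (W : ℤ → Submodule ℂ V) (H : V →ₗ[ℂ] V) : Prop :=
  ((⨆ k : ℤ, Module.End.eigenspace H ((k : ℤ) : ℂ)) = ⊤) ∧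
  ∀ n : ℤ, Disjoint (Module.End.eigenspace H ((n : ℤ) : ℂ)) (W (n - 1)) ∧
    W n = Module.End.eigenspace H ((n : ℤ) : ℂ) ⊔ W (n - 1)

theorem Int.forall_of_le_of_pred {P : ℤ → Prop} (a : ℤ) (base : ∀ n ≤ a, P n)
    (step : ∀ n, P (n - 1) → P n) (n : ℤ) : P n := by
  rcases le_total n a with h | h
  · exact base n h
  · induction n, h using Int.leInduction with
    | base => exact base a le_rfl
    | succ k _ ih => exact step (k + 1) (by simpa using ih)

section Filtered

variable {V : Type*} [AddCommGroup V] [Module ℂ V] {ι : Type*}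
  {W : ℤ → Submodule ℂ V} {v : ι → V} {w : ι → ℤ}

theorem inf_le_span_of_graded {a : ℤ} (hW : Monotone W) (ha : W a = ⊥) {G : Submodule ℂ V}
    {s : Set ι} (hG : ∀ i ∈ s, v i ∈ G)
    (hgr : ∀ n, G ⊓ W n ≤ Submodule.span ℂ (v '' {i | w i = n ∧ i ∈ s}) ⊔ W (n - 1)) (n : ℤ) :
    G ⊓ W n ≤ Submodule.span ℂ (v '' {i | w i ≤ n ∧ i ∈ s}) := by
  refine Int.forall_of_le_of_pred (P := fun n ↦
    G ⊓ W n ≤ Submodule.span ℂ (v '' {i | w i ≤ n ∧ i ∈ s})) a (fun n hn ↦ ?_) (fun n ih ↦ ?_) n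
  · have : W n = ⊥ := le_bot_iff.1 (ha ▸ hW hn)
    simp [this]
  · intro x hx
    obtain ⟨y, hy, z, hz, rfl⟩ := Submodule.mem_sup.1 (hgr n hx)
    have hyG : y ∈ G := by
      refine Submodule.span_le.2 ?_ hy
      rintro _ ⟨i, hi, rfl⟩
      exact hG i hi.2
    have hzG : z ∈ G := by simpa using G.sub_mem hx.1 hyG
    refine Submodule.add_mem _ (Submodule.span_mono (Set.image_mono ?_) hy)
      (Submodule.span_mono (Set.image_mono ?_) (ih ⟨hzG, hz⟩))
    · exact fun i hi ↦ ⟨hi.1.le, hi.2⟩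
    · exact fun i hi ↦ ⟨by have := hi.1; omega, hi.2⟩

theorem filtration_eq_span_of_graded {a : ℤ} (hW : Monotone W) (ha : W a = ⊥)
    (hv : ∀ i, v i ∈ W (w i))
    (hgr : ∀ n, W n ≤ Submodule.span ℂ (v '' {i | w i = n}) ⊔ W (n - 1)) (n : ℤ) :
    W n = Submodule.span ℂ (v '' {i | w i ≤ n}) := by
  apply le_antisymm
  · simpa using inf_le_span_of_graded (G := ⊤) (s := Set.univ) (w := w) (v := v) hW ha
      (by simp) (by simpa using hgr) n
  · rw [Submodule.span_le]
    rintro _ ⟨i, hi, rfl⟩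
    exact hW hi (hv i)

theorem linearIndependent_of_graded {a b : ℤ} (hW : Monotone W) (ha : W a = ⊥) (hb : W b = ⊤)
    (hv : ∀ i, v i ∈ W (w i))
    (hgr : ∀ n, W n ≤ Submodule.span ℂ (v '' {i | w i = n}) ⊔ W (n - 1))
    (hind : ∀ n, LinearIndepOn ℂ ((W (n - 1)).mkQ ∘ v) {i | w i = n}) :
    LinearIndependent ℂ v := by
  have hne : ∀ i, v i ∉ W (w i - 1) := fun i hi ↦
    (hind (w i)).ne_zero (i := i) rfl (by simpa using hi)
  have key : ∀ n, LinearIndepOn ℂ v {i | w i ≤ n} := by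
    refine Int.forall_of_le_of_pred a (fun n hn ↦ ?_) (fun n ih ↦ ?_)
    · convert linearIndepOn_empty ℂ v
      ext i
      simp only [Set.mem_ofPred_eq, Set.mem_empty_iff_false, iff_false]
      intro hi
      have h0 : v i = 0 := by
        have := hW (hi.trans hn) (hv i)
        rwa [ha, Submodule.mem_bot] at this
      exact hne i (h0 ▸ Submodule.zero_mem _)
    · have h : {i | w i ≤ n} = {i | w i ≤ n - 1} ∪ {i | w i = n} := by
        ext i
        simp only [Set.mem_ofPred_eq, Set.mem_union]
        omega
      rw [h]
      refine ih.union_of_quotient ?_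
      rw [← filtration_eq_span_of_graded hW ha hv hgr (n - 1)]
      exact hind n
  rw [← linearIndepOn_univ_iff]
  convert key b
  symm
  rw [Set.eq_univ_iff_forall]
  intro i
  by_contra hi
  simp only [Set.mem_ofPred_eq] at hi
  refine hne i ?_
  have : W (w i - 1) = ⊤ := top_le_iff.1 (hb ▸ hW (by omega))
  simp [this]

end Filtered

section Hodge

variable {Q : Type*} [AddCommGroup Q] [Module ℂ Q] {A B : ℤ → Submodule ℂ Q} {n : ℤ}

theorem inf_eq_bot_of_iSupIndep (hA : Antitone A) (hB : Antitone B)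
    (h : iSupIndep fun p ↦ A p ⊓ B (n - p)) {p q : ℤ} (hpq : p + q = n + 1) :
    A p ⊓ B q = ⊥ := by
  have := h.pairwiseDisjoint (show p ≠ p - 1 by omega)
  rw [eq_bot_iff]
  refine this ?_ ?_
  · exact inf_le_inf_left _ (hB (by omega))
  · exact inf_le_inf (hA (by omega)) (hB (by omega))

theorem left_le_iSup_of_hodge (hA : Antitone A) (hB : Antitone B)
    (h : iSupIndep fun p ↦ A p ⊓ B (n - p)) {k : ℤ} (hk : A k ≤ ⨆ p, A p ⊓ B (n - p)) :
    A k ≤ ⨆ p ≥ k, A p ⊓ B (n - p) := by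
  intro x hx
  have hle : (⨆ p, A p ⊓ B (n - p)) ≤ (⨆ p ≥ k, A p ⊓ B (n - p)) ⊔ B (n - k + 1) := by
    refine iSup_le fun p ↦ ?_
    rcases le_or_gt k p with hp | hp
    · exact le_sup_of_le_left (le_iSup₂_of_le p hp le_rfl)
    · exact le_sup_of_le_right (inf_le_right.trans (hB (by omega)))
  obtain ⟨y, hy, z, hz, rfl⟩ := Submodule.mem_sup.1 (hle (hk hx))
  have hyA : y ∈ A k := iSup₂_le (fun p hp ↦ inf_le_left.trans (hA hp)) hy
  have hzA : z ∈ A k := by simpa using (A k).sub_mem hx hyA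
  have : z ∈ A k ⊓ B (n - k + 1) := ⟨hzA, hz⟩
  rw [inf_eq_bot_of_iSupIndep hA hB h (by omega), Submodule.mem_bot] at this
  simpa [this] using hy

theorem right_le_iSup_of_hodge (hA : Antitone A) (hB : Antitone B)
    (h : iSupIndep fun p ↦ A p ⊓ B (n - p)) {k : ℤ} (hk : B k ≤ ⨆ p, A p ⊓ B (n - p)) :
    B k ≤ ⨆ p, ⨆ (_ : k ≤ n - p), A p ⊓ B (n - p) := by
  intro x hx
  have hle : (⨆ p, A p ⊓ B (n - p)) ≤
      (⨆ p, ⨆ (_ : k ≤ n - p), A p ⊓ B (n - p)) ⊔ A (n - k + 1) := by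
    refine iSup_le fun p ↦ ?_
    rcases le_or_gt k (n - p) with hp | hp
    · exact le_sup_of_le_left (le_iSup₂_of_le p hp le_rfl)
    · exact le_sup_of_le_right (inf_le_left.trans (hA (by omega)))
  obtain ⟨y, hy, z, hz, rfl⟩ := Submodule.mem_sup.1 (hle (hk hx))
  have hyB : y ∈ B k := iSup₂_le (fun p hp ↦ inf_le_right.trans (hB hp)) hy
  have hzB : z ∈ B k := by simpa using (B k).sub_mem hx hyB
  have : z ∈ A (n - k + 1) ⊓ B k := ⟨hz, hzB⟩
  rw [inf_eq_bot_of_iSupIndep hA hB h (by omega), Submodule.mem_bot] at this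
  simpa [this] using hy

end Hodge

section MHS

variable {V : Type*} [AddCommGroup V] [Module ℂ V] {W F Fb : ℤ → Submodule ℂ V}

theorem grPiece_antitone {F : ℤ → Submodule ℂ V} (hF : Antitone F) (n : ℤ) :
    Antitone fun p ↦ grPiece W n (F p) :=
  fun _ _ h ↦ Submodule.map_mono (inf_le_inf_right _ (hF h))

theorem inf_le_sup_of_grPiece_le {n : ℤ} {G U : Submodule ℂ V}
    (h : grPiece W n G ≤ U.map (W (n - 1)).mkQ) : G ⊓ W n ≤ U ⊔ W (n - 1) := by
  have := (Submodule.map_le_iff_le_comap.1 (show (G ⊓ W n).map _ ≤ _ from h))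
  rwa [Submodule.comap_map_mkQ, sup_comm] at this

theorem IsMHS.mem_of_opposed (h : IsMHS W F Fb) {n p q : ℤ} (hpq : p + q = n + 1) {x y z : V}
    (hx : x ∈ F p) (hxW : x ∈ W n) (hy : y ∈ Fb q) (hz : z ∈ W (n - 1)) (hxyz : x = y + z) :
    x ∈ W (n - 1) := by
  obtain ⟨hW, hF, hFb, -, -, hgr⟩ := h
  have hyW : y ∈ W n := by
    have := (W n).sub_mem hxW (hW (by omega) hz)
    simpa [hxyz] using this
  have := inf_eq_bot_of_iSupIndep (A := fun p ↦ grPiece W n (F p))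
    (B := fun q ↦ grPiece W n (Fb q)) (grPiece_antitone hF n) (grPiece_antitone hFb n)
    (hgr n).2 hpq
  have hmem : (W (n - 1)).mkQ x ∈ grPiece W n (F p) ⊓ grPiece W n (Fb q) := by
    refine ⟨⟨x, ⟨hx, hxW⟩, rfl⟩, ⟨y, ⟨hy, hyW⟩, ?_⟩⟩
    rw [hxyz, map_add, show (W (n - 1)).mkQ z = 0 from
      (Submodule.Quotient.mk_eq_zero _).2 hz, add_zero]
  rw [this, Submodule.mem_bot] at hmem
  simpa using hmem

theorem iSupIndep.exists_linearIndependent_family {Q : Type*} [AddCommGroup Q] [Module ℂ Q]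
    [FiniteDimensional ℂ Q] {T : ℤ → Submodule ℂ Q} (hT : iSupIndep T) :
    ∃ (κ : Type) (e : κ → Q) (d : κ → ℤ), LinearIndependent ℂ e ∧ (∀ j, e j ∈ T (d j)) ∧
      ∀ p, T p ≤ Submodule.span ℂ (e '' {j | d j = p}) := by
  refine ⟨Σ p : ℤ, Fin (Module.finrank ℂ (T p)),
    fun j ↦ (Module.finBasis ℂ (T j.1) j.2 : T j.1), Sigma.fst, ?_, fun j ↦ Subtype.property _,
    fun p x hx ↦ ?_⟩
  · refine linearIndependent_iUnion_finite
      (f := fun p (j : Fin (Module.finrank ℂ (T p))) ↦ ((Module.finBasis ℂ (T p) j : T p) : Q))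
      (fun p ↦ ?_) (fun p t _ hp ↦ ?_)
    · exact (Module.finBasis ℂ (T p)).linearIndependent.map' (T p).subtype
        (Submodule.ker_subtype _)
    · have hle : ∀ p, Submodule.span ℂ (Set.range fun j : Fin (Module.finrank ℂ (T p)) ↦
          ((Module.finBasis ℂ (T p) j : T p) : Q)) ≤ T p := by
        intro p
        rw [Submodule.span_le]
        rintro _ ⟨j, rfl⟩
        exact Subtype.property _
      exact (hT.disjoint_biSup hp).mono (hle p) (iSup₂_mono fun p _ ↦ hle p)
  · have := (Module.finBasis ℂ (T p)).mem_span ⟨x, hx⟩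
    have := Submodule.mem_map_of_mem (f := (T p).subtype) this
    rw [Submodule.map_span] at this
    refine Submodule.span_mono ?_ this
    rintro _ ⟨_, ⟨i, rfl⟩, rfl⟩
    exact ⟨⟨p, i⟩, rfl, rfl⟩

theorem exists_basis_of_graded_lift {a b : ℤ} (hW : Monotone W) (ha : W a = ⊥) (hb : W b = ⊤)
    {κ : ℤ → Type} {e : ∀ n, κ n → V ⧸ W (n - 1)} (he : ∀ n, LinearIndependent ℂ (e n))
    (hspan : ∀ n, (W n).map (W (n - 1)).mkQ ≤ Submodule.span ℂ (Set.range (e n)))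
    {v : (Σ n, κ n) → V} (hvW : ∀ i, v i ∈ W i.1)
    (hv : ∀ i, (W (i.1 - 1)).mkQ (v i) = e i.1 i.2) :
    ∃ v' : Module.Basis (Σ n, κ n) ℂ V, ⇑v' = v ∧
      (∀ n, W n = Submodule.span ℂ (v '' {i | i.1 ≤ n})) ∧
      ∀ (G : Submodule ℂ V) (s : Set (Σ n, κ n)), (∀ i ∈ s, v i ∈ G) →
        (∀ n, grPiece W n G ≤ Submodule.span ℂ (e n '' {j | ⟨n, j⟩ ∈ s})) →
        G = Submodule.span ℂ (v '' s) := by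
  have himage : ∀ n (s : Set (Σ n, κ n)),
      (Submodule.span ℂ (v '' {i | i.1 = n ∧ i ∈ s})).map (W (n - 1)).mkQ =
        Submodule.span ℂ (e n '' {j | ⟨n, j⟩ ∈ s}) := by
    intro n s
    rw [Submodule.map_span, ← Set.image_comp]
    congr 1
    ext x
    constructor
    · rintro ⟨⟨m, j⟩, ⟨hm, hi⟩, rfl⟩
      obtain rfl : m = n := hm
      exact ⟨j, hi, (hv ⟨m, j⟩).symm⟩
    · rintro ⟨j, hj, rfl⟩
      exact ⟨⟨n, j⟩, ⟨rfl, hj⟩, hv ⟨n, j⟩⟩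
  have hgrind : ∀ n, LinearIndepOn ℂ ((W (n - 1)).mkQ ∘ v) {i | i.1 = n} := by
    intro n
    have : {i : Σ n, κ n | i.1 = n} = Set.range (Sigma.mk n) := by
      ext ⟨m, j⟩
      constructor
      · rintro rfl
        exact ⟨j, rfl⟩
      · rintro ⟨j, h⟩
        exact (congrArg Sigma.fst h).symm
    rw [this, linearIndepOn_range_iff sigma_mk_injective]
    convert he n using 1
    ext j
    exact hv ⟨n, j⟩
  have hgrspan : ∀ n, W n ≤ Submodule.span ℂ (v '' {i | i.1 = n}) ⊔ W (n - 1) := by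
    intro n
    have := inf_le_sup_of_grPiece_le (W := W) (n := n) (G := ⊤)
      (U := Submodule.span ℂ (v '' {i | i.1 = n ∧ i ∈ Set.univ})) (by
        rw [himage n]
        simpa [grPiece] using hspan n)
    simpa using this
  have hli := linearIndependent_of_graded hW ha hb hvW hgrspan hgrind
  have hWspan := filtration_eq_span_of_graded hW ha hvW hgrspan
  refine ⟨Module.Basis.mk hli ?_, Module.Basis.coe_mk _ _, hWspan, fun G s hG hGgr ↦ ?_⟩
  · rw [← hb, hWspan b]
    exact Submodule.span_mono (Set.image_subset_range _ _)
  · apply le_antisymm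
    · have := inf_le_span_of_graded (v := v) (w := Sigma.fst) hW ha hG
        (fun n ↦ inf_le_sup_of_grPiece_le ((hGgr n).trans (himage n s).ge)) b
      rw [hb, inf_top_eq] at this
      exact this.trans (Submodule.span_mono (Set.image_mono fun i hi ↦ hi.2))
    · rw [Submodule.span_le]
      rintro _ ⟨i, hi, rfl⟩
      exact hG i hi

theorem IsMHS.exists_adapted_bases [FiniteDimensional ℂ V] (h : IsMHS W F Fb) :
    ∃ (ι : Type) (_ : Fintype ι) (b c : Module.Basis ι ℂ V) (p q : ι → ℤ),
      (∀ n, W n = Submodule.span ℂ (b '' {i | p i + q i ≤ n})) ∧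
      (∀ n, W n = Submodule.span ℂ (c '' {i | p i + q i ≤ n})) ∧
      (∀ k, F k = Submodule.span ℂ (b '' {i | k ≤ p i})) ∧
      (∀ k, Fb k = Submodule.span ℂ (c '' {i | k ≤ q i})) ∧
      ∀ i, b i - c i ∈ W (p i + q i - 1) := by
  obtain ⟨hW, hF, hFb, ⟨l, hl⟩, ⟨u, hu⟩, hgr⟩ := h
  choose κ e d hind hmem hT using fun n ↦ (hgr n).2.exists_linearIndependent_family
  have hspan : ∀ n, (W n).map (W (n - 1)).mkQ ≤ Submodule.span ℂ (Set.range (e n)) := by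
    intro n
    rw [(hgr n).1]
    exact iSup_le fun p ↦ (hT n p).trans (Submodule.span_mono (Set.image_subset_range _ _))
  have hgrle : ∀ n (G : Submodule ℂ V),
      grPiece W n G ≤ ⨆ p, grPiece W n (F p) ⊓ grPiece W n (Fb (n - p)) := by
    intro n G
    rw [← (hgr n).1]
    exact Submodule.map_mono inf_le_right
  have hb : ∀ i : Σ n, κ n, ∃ x ∈ F (d i.1 i.2) ⊓ W i.1, (W (i.1 - 1)).mkQ x = e i.1 i.2 :=
    fun i ↦ (hmem i.1 i.2).1
  have hc : ∀ i : Σ n, κ n,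
      ∃ x ∈ Fb (i.1 - d i.1 i.2) ⊓ W i.1, (W (i.1 - 1)).mkQ x = e i.1 i.2 :=
    fun i ↦ (hmem i.1 i.2).2
  choose b hb hbe using hb
  choose c hc hce using hc
  obtain ⟨b', rfl, hbW, hbG⟩ :=
    exists_basis_of_graded_lift hW hl hu hind hspan (fun i ↦ (hb i).2) hbe
  obtain ⟨c', rfl, hcW, hcG⟩ :=
    exists_basis_of_graded_lift hW hl hu hind hspan (fun i ↦ (hc i).2) hce
  have hfin : Finite (Σ n, κ n) := Module.Finite.finite_basis b'
  refine ⟨Σ n, κ n, Fintype.ofFinite _, b', c', fun i ↦ d i.1 i.2, fun i ↦ i.1 - d i.1 i.2,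
    by simpa using hbW, by simpa using hcW, fun k ↦ ?_, fun k ↦ ?_, fun i ↦ ?_⟩
  · refine hbG _ _ (fun i hi ↦ hF hi (hb i).1) fun n ↦ ?_
    refine (left_le_iSup_of_hodge (A := fun p ↦ grPiece W n (F p))
      (B := fun q ↦ grPiece W n (Fb q)) (grPiece_antitone hF n) (grPiece_antitone hFb n)
      (hgr n).2 (hgrle n _)).trans ?_
    exact iSup₂_le fun p hp ↦ (hT n p).trans (Submodule.span_mono
      (Set.image_mono (by rintro j rfl; exact hp)))
  · refine hcG _ _ (fun i hi ↦ hFb hi (hc i).1) fun n ↦ ?_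
    refine (right_le_iSup_of_hodge (A := fun p ↦ grPiece W n (F p))
      (B := fun q ↦ grPiece W n (Fb q)) (grPiece_antitone hF n) (grPiece_antitone hFb n)
      (hgr n).2 (hgrle n _)).trans ?_
    exact iSup₂_le fun p hp ↦ (hT n p).trans (Submodule.span_mono
      (Set.image_mono (by rintro j rfl; exact hp)))
  · rw [add_sub_cancel, ← Submodule.Quotient.mk_eq_zero]
    have := (hbe i).trans (hce i).symm
    simpa [sub_eq_zero] using this

end MHS

section Endomorphisms

variable {V : Type*} [AddCommGroup V] [Module ℂ V] {W F Fb : ℤ → Submodule ℂ V}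

theorem mem_shiftEnd_of_span {ι : Type*} {G : ℤ → Submodule ℂ V} {v : ι → V} {s : ℤ → Set ι}
    (hG : ∀ n, G n = Submodule.span ℂ (v '' s n)) {A : V →ₗ[ℂ] V} {k : ℤ}
    (hA : ∀ n, ∀ i ∈ s n, A (v i) ∈ G (n + k)) : A ∈ shiftEnd G k := by
  intro n
  change G n ≤ (G (n + k)).comap A
  rw [hG n, Submodule.span_le]
  rintro _ ⟨i, hi, rfl⟩
  exact hA n i hi

theorem shiftEnd_mono {G : ℤ → Submodule ℂ V} (hG : Monotone G) : Monotone (shiftEnd G) :=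
  fun _ _ h _ hA n v hv ↦ hG (by omega) (hA n v hv)

theorem shiftEnd_anti {G : ℤ → Submodule ℂ V} (hG : Antitone G) : Antitone (shiftEnd G) :=
  fun _ _ h _ hA n v hv ↦ hG (by omega) (hA n v hv)

theorem eq_zero_of_mem_shiftEnd {G : ℤ → Submodule ℂ V} (hG : Monotone G) {a b m : ℤ}
    (ha : G a = ⊥) (hb : G b = ⊤) (hm : b - a ≤ m) {A : V →ₗ[ℂ] V} (hA : A ∈ shiftEnd G (-m)) :
    A = 0 := by
  ext v
  have : A v ∈ G a := hG (by omega) (hA b v (by simp [hb]))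
  simpa [ha] using this

/-- `F̄⁰End(V) ∩ W₀End(V) + Σ_{k≥1} (F̄^{−k}End(V) ∩ W_{−k−1}End(V))`. -/
def oppositePart (W Fb : ℤ → Submodule ℂ V) : Submodule ℂ (V →ₗ[ℂ] V) :=
  (shiftEnd Fb 0 ⊓ shiftEnd W 0) ⊔
    ⨆ k : ℕ, shiftEnd Fb (-(k : ℤ) - 1) ⊓ shiftEnd W (-(k : ℤ) - 2)

theorem le_oppositePart (hW : Monotone W) {m : ℤ} (hm : 1 ≤ m) :
    shiftEnd Fb (-m + 1) ⊓ shiftEnd W (-m) ≤ oppositePart W Fb := by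
  rcases hm.eq_or_lt with rfl | hm
  · exact le_sup_of_le_left (inf_le_inf_left _ (shiftEnd_mono hW (by omega)))
  · obtain ⟨k, rfl⟩ : ∃ k : ℕ, m = k + 2 := ⟨(m - 2).toNat, by omega⟩
    refine le_sup_of_le_right (le_iSup_of_le k (le_of_eq ?_))
    congr 2 <;> ring

theorem oppositePart_le (hW : Monotone W) (hFb : Antitone Fb) {m : ℤ} (hm : 1 ≤ m) :
    oppositePart W Fb ≤ shiftEnd Fb (-m + 1) ⊔ shiftEnd W (-m - 1) := by
  refine sup_le (le_sup_of_le_left (inf_le_left.trans (shiftEnd_anti hFb (by omega))))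
    (iSup_le fun k ↦ ?_)
  rcases le_or_gt (-m + 1) (-(k : ℤ) - 1) with h | h
  · exact le_sup_of_le_left (inf_le_left.trans (shiftEnd_anti hFb h))
  · exact le_sup_of_le_right (inf_le_right.trans (shiftEnd_mono hW (by omega)))

theorem IsMHS.exists_graded_decomposition [FiniteDimensional ℂ V] (h : IsMHS W F Fb) {m : ℤ}
    {A : V →ₗ[ℂ] V} (hA : A ∈ shiftEnd W (-m)) :
    ∃ B ∈ shiftEnd F 0 ⊓ shiftEnd W (-m), ∃ C ∈ shiftEnd Fb (-m + 1) ⊓ shiftEnd W (-m),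
      A - B - C ∈ shiftEnd W (-m - 1) := by
  obtain ⟨ι, _, b, c, p, q, hbW, hcW, hbF, hcF, hbc⟩ := h.exists_adapted_bases
  have hW := h.1
  have hb : ∀ {i n}, p i + q i ≤ n → b i ∈ W n := fun {i n} hi ↦
    hbW n ▸ Submodule.subset_span ⟨i, hi, rfl⟩
  have hc : ∀ {i n}, p i + q i ≤ n → c i ∈ W n := fun {i n} hi ↦
    hcW n ▸ Submodule.subset_span ⟨i, hi, rfl⟩
  classical
  let B : V →ₗ[ℂ] V := b.constr ℂ fun i ↦
    ∑ j, (if p j + q j = p i + q i - m ∧ p i ≤ p j then b.repr (A (b i)) j else 0) • b j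
  let C : V →ₗ[ℂ] V := c.constr ℂ fun i ↦
    ∑ j, (if p j + q j = p i + q i - m ∧ p j < p i then b.repr (A (b i)) j else 0) • c j
  have hB : ∀ i, B (b i) = ∑ j,
      (if p j + q j = p i + q i - m ∧ p i ≤ p j then b.repr (A (b i)) j else 0) • b j :=
    fun i ↦ b.constr_basis ℂ _ i
  have hC : ∀ i, C (c i) = ∑ j,
      (if p j + q j = p i + q i - m ∧ p j < p i then b.repr (A (b i)) j else 0) • c j :=
    fun i ↦ c.constr_basis ℂ _ i
  have hCW : C ∈ shiftEnd W (-m) := by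
    refine mem_shiftEnd_of_span hcW fun n i hi ↦ ?_
    rw [hC]
    refine Submodule.sum_mem _ fun j _ ↦ ?_
    split_ifs with hj
    · exact Submodule.smul_mem _ _ (hc (by simp only [Set.mem_ofPred_eq] at hi; omega))
    · simp
  refine ⟨B, ⟨?_, ?_⟩, C, ⟨?_, hCW⟩, ?_⟩
  · refine mem_shiftEnd_of_span hbF fun n i hi ↦ ?_
    rw [hB]
    refine Submodule.sum_mem _ fun j _ ↦ ?_
    split_ifs with hj
    · refine Submodule.smul_mem _ _ ?_
      rw [hbF]
      exact Submodule.subset_span ⟨j, by simp only [Set.mem_ofPred_eq] at hi ⊢; omega, rfl⟩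
    · simp
  · refine mem_shiftEnd_of_span hbW fun n i hi ↦ ?_
    rw [hB]
    refine Submodule.sum_mem _ fun j _ ↦ ?_
    split_ifs with hj
    · exact Submodule.smul_mem _ _ (hb (by simp only [Set.mem_ofPred_eq] at hi; omega))
    · simp
  · refine mem_shiftEnd_of_span hcF fun n i hi ↦ ?_
    rw [hC]
    refine Submodule.sum_mem _ fun j _ ↦ ?_
    split_ifs with hj
    · refine Submodule.smul_mem _ _ ?_
      rw [hcF]
      exact Submodule.subset_span ⟨j, by simp only [Set.mem_ofPred_eq] at hi ⊢; omega, rfl⟩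
    · simp
  · refine mem_shiftEnd_of_span hbW fun n i hi ↦ hW (a := p i + q i - m - 1)
      (by simp only [Set.mem_ofPred_eq] at hi; omega) ?_
    have hsplit : (A - B - C) (b i) = (A (b i) - B (b i) - C (c i)) - C (b i - c i) := by
      simp only [LinearMap.sub_apply, map_sub]
      abel
    rw [hsplit]
    refine Submodule.sub_mem _ ?_ (hW (by omega) (hCW _ _ (hbc i)))
    rw [hB, hC, ← b.sum_repr (A (b i)), ← Finset.sum_sub_distrib, ← Finset.sum_sub_distrib]
    simp only [b.sum_repr]
    refine Submodule.sum_mem _ fun j _ ↦ ?_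
    rcases lt_trichotomy (p j + q j) (p i + q i - m) with hj | hj | hj
    · rw [if_neg (by omega), if_neg (by omega)]
      simpa using Submodule.smul_mem _ _ (hb (by omega))
    · rcases le_or_gt (p i) (p j) with hij | hij
      · rw [if_pos ⟨hj, hij⟩, if_neg (by omega)]
        simp
      · rw [if_neg (by omega), if_pos ⟨hj, hij⟩, zero_smul, sub_zero, ← smul_sub]
        exact Submodule.smul_mem _ _ (hW (by omega) (hbc j))
    · have hAb := hA _ _ (hb (le_refl (p i + q i)))
      rw [hbW, b.mem_span_image] at hAb
      have : b.repr (A (b i)) j = 0 := by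
        by_contra h0
        have := hAb (Finsupp.mem_support_iff.2 h0)
        simp only [Set.mem_ofPred_eq] at this
        omega
      simp [this]

theorem IsMHS.exists_sub_mem_oppositePart [FiniteDimensional ℂ V] (h : IsMHS W F Fb) {m : ℤ}
    (hm : 1 ≤ m) {A : V →ₗ[ℂ] V} (hA : A ∈ shiftEnd W (-m)) :
    ∃ B ∈ shiftEnd F 0 ⊓ shiftEnd W (-m), A - B ∈ oppositePart W Fb := by
  have hW := h.1
  obtain ⟨a, ha⟩ := h.2.2.2.1
  obtain ⟨b, hb⟩ := h.2.2.2.2.1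
  induction hk : (b - a - m).toNat generalizing m A with
  | zero =>
    rw [eq_zero_of_mem_shiftEnd hW ha hb (by omega) hA]
    exact ⟨0, Submodule.zero_mem _, by simp⟩
  | succ k ih =>
    obtain ⟨B, hB, C, hC, hABC⟩ := h.exists_graded_decomposition hA
    rw [show -m - 1 = -(m + 1) by ring] at hABC
    obtain ⟨D, hD, hD'⟩ := ih (by omega) hABC (by omega)
    refine ⟨B + D, Submodule.add_mem _ hB ⟨hD.1, shiftEnd_mono hW (by omega) hD.2⟩, ?_⟩
    have := Submodule.add_mem _ hD' (le_oppositePart hW hm hC)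
    convert this using 1
    abel

theorem IsMHS.apply_mem_of_mem_oppositePart (h : IsMHS W F Fb) {m p q : ℤ} (hm : 1 ≤ m)
    {A : V →ₗ[ℂ] V} (hA : A ∈ oppositePart W Fb) {x y u : V} (hx : x ∈ W (p + q))
    (hxq : x ∈ Fb q) (hy : y ∈ Fb (q - m + 1)) (hu : u ∈ F p) (huW : u ∈ W (p + q - m))
    (hux : u - A x - y ∈ W (p + q - m - 1)) : u ∈ W (p + q - m - 1) := by
  obtain ⟨B, hB, C, hC, rfl⟩ := Submodule.mem_sup.1 (oppositePart_le h.1 h.2.2.1 hm hA)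
  refine h.mem_of_opposed (n := p + q - m) (p := p) (q := q - m + 1) (by ring) hu huW
    (y := B x + y) (z := C x + (u - (B + C) x - y)) ?_ ?_ ?_
  · refine Submodule.add_mem _ ?_ hy
    have := hB q x hxq
    rwa [show q + (-m + 1) = q - m + 1 by ring] at this
  · refine Submodule.add_mem _ ?_ hux
    have := hC _ x hx
    rwa [show p + q + (-m - 1) = p + q - m - 1 by ring] at this
  · simp only [LinearMap.add_apply]
    abel

theorem IsMHS.eq_zero_of_mem_oppositePart [FiniteDimensional ℂ V] (h : IsMHS W F Fb)
    {A : V →ₗ[ℂ] V} (hF : A ∈ shiftEnd F 0) (hA : A ∈ shiftEnd W (-1))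
    (hA' : A ∈ oppositePart W Fb) : A = 0 := by
  have hW := h.1
  obtain ⟨ι, _, b, c, p, q, hbW, hcW, hbF, hcF, hbc⟩ := h.exists_adapted_bases
  have key : ∀ m : ℤ, 1 ≤ m → A ∈ shiftEnd W (-m) := by
    intro m hm
    induction m, hm using Int.leInduction with
    | base => exact hA
    | succ m hm ih =>
      refine mem_shiftEnd_of_span hbW fun n i hi ↦ hW (a := p i + q i - m - 1)
        (by simp only [Set.mem_ofPred_eq] at hi; omega) ?_
      have hbi : b i ∈ W (p i + q i) := hbW _ ▸ Submodule.subset_span ⟨i, le_refl (p i + q i), rfl⟩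
      have hci : c i ∈ W (p i + q i) := hcW _ ▸ Submodule.subset_span ⟨i, le_refl (p i + q i), rfl⟩
      have hbFi : b i ∈ F (p i) := hbF _ ▸ Submodule.subset_span ⟨i, le_refl (p i), rfl⟩
      have hcFi : c i ∈ Fb (q i) := hcF _ ▸ Submodule.subset_span ⟨i, le_refl (q i), rfl⟩
      refine h.apply_mem_of_mem_oppositePart hm hA' hci hcFi (y := 0) (Submodule.zero_mem _)
        (by simpa using hF _ _ hbFi) (ih _ _ hbi) ?_
      rw [sub_zero, ← map_sub]
      exact hW (by omega) (ih _ _ (hbc i))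
  obtain ⟨l, hl⟩ := h.2.2.2.1
  obtain ⟨u, hu⟩ := h.2.2.2.2.1
  exact eq_zero_of_mem_shiftEnd hW hl hu (le_max_left (u - l) 1) (key _ (le_max_right _ _))

end Endomorphisms

section Splitting

variable {V : Type*} [AddCommGroup V] [Module ℂ V] {W : ℤ → Submodule ℂ V} {H : V →ₗ[ℂ] V}

theorem mem_of_mem_eigenspace {k l n : ℤ} (hW : Monotone W)
    (hH : ∀ n : ℤ, ∀ v ∈ W n, H v - (n : ℂ) • v ∈ W (n - 1))
    {v : V} (hv : H v = (n : ℂ) • v) (hk : v ∈ W k) (hl : ∀ j, l < j → j ≤ k → j ≠ n) :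
    v ∈ W l := by
  induction hd : (k - l).toNat generalizing k with
  | zero => exact hW (by omega) hk
  | succ d ih =>
    refine ih (k := k - 1) ?_ (fun j hj hjk ↦ hl j hj (by omega)) (by omega)
    have := hH k v hk
    rw [hv, ← sub_smul] at this
    refine (Submodule.smul_mem_iff _ ?_).1 this
    rw [sub_ne_zero]
    exact_mod_cast (hl k (by omega) le_rfl).symm

theorem isWeightSplitting_of_graded [FiniteDimensional ℂ V] {a b : ℤ} (hW : Monotone W)
    (ha : W a = ⊥) (hb : W b = ⊤) (hH : ∀ n : ℤ, ∀ v ∈ W n, H v - (n : ℂ) • v ∈ W (n - 1)) :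
    IsWeightSplitting W H := by
  have hzero : ∀ (n : ℤ) (v : V), H v = (n : ℂ) • v → v ∈ W (n - 1) → v = 0 := by
    intro n v hv hvW
    have : v ∈ W a :=
      mem_of_mem_eigenspace hW hH hv hvW (fun j _ hj ↦ by omega)
    simpa [ha] using this
  have hle : ∀ n : ℤ, W n ≤ Module.End.eigenspace H (n : ℂ) ⊔ W (n - 1) := by
    intro n v hv
    let A : V →ₗ[ℂ] V := H - (n : ℂ) • LinearMap.id
    have hA : ∀ x ∈ W (n - 1), A x ∈ W (n - 1) := by
      intro x hx
      exact hH n x (hW (by omega) hx)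
    have hinj : Function.Injective (A.restrict hA) := by
      rw [← LinearMap.ker_eq_bot, LinearMap.ker_eq_bot']
      rintro ⟨x, hx⟩ h0
      have h0 : A x = 0 := congrArg Subtype.val h0
      exact Subtype.ext (hzero n x (sub_eq_zero.1 (by simpa [A] using h0)) hx)
    obtain ⟨⟨y, hy⟩, hyv⟩ := LinearMap.injective_iff_surjective.1 hinj ⟨A v, hH n v hv⟩
    have hyv : A y = A v := congrArg Subtype.val hyv
    refine Submodule.mem_sup.2 ⟨v - y, ?_, y, hy, by simp⟩
    rw [Module.End.mem_eigenspace_iff, ← sub_eq_zero]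
    have : A (v - y) = 0 := by rw [map_sub, hyv, sub_self]
    simpa [A] using this
  refine ⟨?_, fun n ↦ ⟨?_, le_antisymm (hle n) (sup_le (fun v hv ↦ ?_) (hW (by omega)))⟩⟩
  · have key : ∀ n : ℤ, W n ≤ ⨆ k : ℤ, Module.End.eigenspace H ((k : ℤ) : ℂ) := by
      refine Int.forall_of_le_of_pred a (fun n hn ↦ ?_) (fun n ih ↦ ?_)
      · exact (hW hn).trans (ha ▸ bot_le)
      · exact (hle n).trans (sup_le (le_iSup (fun k : ℤ ↦ Module.End.eigenspace H (k : ℂ)) n) ih)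
    exact top_le_iff.1 (hb ▸ key b)
  · rw [Submodule.disjoint_def]
    exact fun v hv ↦ hzero n v (Module.End.mem_eigenspace_iff.1 hv)
  · exact mem_of_mem_eigenspace hW hH (Module.End.mem_eigenspace_iff.1 hv)
      (k := max n b) (hW (le_max_right _ _) (by simp [hb])) (fun j hj _ ↦ by omega)

theorem IsWeightSplitting.apply_sub_smul_mem (h : IsWeightSplitting W H)
    (hH : H ∈ shiftEnd W 0) (n : ℤ) (v : V) (hv : v ∈ W n) :
    H v - (n : ℂ) • v ∈ W (n - 1) := by
  rw [(h.2 n).2] at hv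
  obtain ⟨x, hx, y, hy, rfl⟩ := Submodule.mem_sup.1 hv
  rw [Module.End.mem_eigenspace_iff] at hx
  rw [map_add, hx, smul_add, add_sub_add_left_eq_sub]
  exact Submodule.sub_mem _ (by simpa using hH _ y hy) (Submodule.smul_mem _ _ hy)

theorem exists_mem_shiftEnd_graded {ι : Type*} {G : ℤ → Submodule ℂ V}
    (b : Module.Basis ι ℂ V) (w : ι → ℤ) {s : ℤ → Set ι}
    (hbW : ∀ n, W n = Submodule.span ℂ (b '' {i | w i ≤ n}))
    (hbG : ∀ n, G n = Submodule.span ℂ (b '' s n)) :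
    ∃ H ∈ shiftEnd G 0 ⊓ shiftEnd W 0, ∀ n : ℤ, ∀ v ∈ W n, H v - (n : ℂ) • v ∈ W (n - 1) := by
  let H : V →ₗ[ℂ] V := b.constr ℂ fun i ↦ (w i : ℂ) • b i
  have hH : ∀ i, H (b i) = (w i : ℂ) • b i := fun i ↦ b.constr_basis ℂ _ i
  refine ⟨H, ⟨mem_shiftEnd_of_span hbG fun n i hi ↦ ?_, mem_shiftEnd_of_span hbW fun n i hi ↦ ?_⟩,
    fun n ↦ ?_⟩
  · rw [hH, add_zero, hbG]
    exact Submodule.smul_mem _ _ (Submodule.subset_span ⟨i, hi, rfl⟩)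
  · rw [hH, add_zero, hbW]
    exact Submodule.smul_mem _ _ (Submodule.subset_span ⟨i, hi, rfl⟩)
  · change W n ≤ (W (n - 1)).comap (H - (n : ℂ) • LinearMap.id)
    rw [hbW n, Submodule.span_le]
    rintro _ ⟨i, hi, rfl⟩
    simp only [Set.mem_ofPred_eq] at hi
    simp only [Submodule.comap_coe, Set.mem_preimage, SetLike.mem_coe, LinearMap.sub_apply,
      LinearMap.smul_apply, LinearMap.id_apply, hH, ← sub_smul]
    rcases hi.eq_or_lt with rfl | hi
    · simp
    · rw [hbW (n - 1)]
      exact Submodule.smul_mem _ _ (Submodule.subset_span ⟨i, Int.le_sub_one_of_lt hi, rfl⟩)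

end Splitting

theorem deligne_splitting_exists_unique
    {V : Type*} [AddCommGroup V] [Module ℂ V] [FiniteDimensional ℂ V]
    (W F Fb : ℤ → Submodule ℂ V) (hMHS : IsMHS W F Fb) :
    ∃ H : V →ₗ[ℂ] V,
      (IsWeightSplitting W H ∧
        H ∈ shiftEnd F 0 ⊓ shiftEnd W 0 ⊓
          ((shiftEnd Fb 0 ⊓ shiftEnd W 0) ⊔
            ⨆ k : ℕ, shiftEnd Fb (-(k : ℤ) - 1) ⊓ shiftEnd W (-(k : ℤ) - 2)) ∧
        (∀ p q : ℤ, ∀ v ∈ F p ⊓ W (p + q) ⊓ Fb q, H v = ((p + q : ℤ) : ℂ) • v)) ∧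
      ∀ H' : V →ₗ[ℂ] V,
        IsWeightSplitting W H' →
        H' ∈ shiftEnd F 0 ⊓ shiftEnd W 0 ⊓
          ((shiftEnd Fb 0 ⊓ shiftEnd W 0) ⊔
            ⨆ k : ℕ, shiftEnd Fb (-(k : ℤ) - 1) ⊓ shiftEnd W (-(k : ℤ) - 2)) →
        H' = H := by
  change ∃ H : V →ₗ[ℂ] V, (IsWeightSplitting W H ∧
    H ∈ shiftEnd F 0 ⊓ shiftEnd W 0 ⊓ oppositePart W Fb ∧ _) ∧ ∀ H' : V →ₗ[ℂ] V, _ →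
      H' ∈ shiftEnd F 0 ⊓ shiftEnd W 0 ⊓ oppositePart W Fb → _
  have hW := hMHS.1
  obtain ⟨l, hl⟩ := hMHS.2.2.2.1
  obtain ⟨u, hu⟩ := hMHS.2.2.2.2.1
  obtain ⟨ι, _, b, c, p, q, hbW, hcW, hbF, hcF, -⟩ := hMHS.exists_adapted_bases
  obtain ⟨A, hA, hAgr⟩ := exists_mem_shiftEnd_graded b _ hbW hbF
  obtain ⟨B, hB, hBgr⟩ := exists_mem_shiftEnd_graded c _ hcW hcF
  have hAB : A - B ∈ shiftEnd W (-1) := fun n v hv ↦ by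
    simpa [← sub_eq_add_neg] using Submodule.sub_mem _ (hAgr n v hv) (hBgr n v hv)
  obtain ⟨C, hC, hABC⟩ := hMHS.exists_sub_mem_oppositePart le_rfl hAB
  have hgr : ∀ n : ℤ, ∀ v ∈ W n, (A - C) v - (n : ℂ) • v ∈ W (n - 1) := fun n v hv ↦ by
    have := Submodule.sub_mem _ (hAgr n v hv) (hC.2 n v hv)
    rwa [sub_right_comm] at this
  have hF : A - C ∈ shiftEnd F 0 := Submodule.sub_mem _ hA.1 hC.1
  have hW0 : A - C ∈ shiftEnd W 0 :=
    Submodule.sub_mem _ hA.2 (shiftEnd_mono hW (by omega) hC.2)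
  have hopp : A - C ∈ oppositePart W Fb := by
    have := Submodule.add_mem _ hABC (Submodule.mem_sup_left hB)
    rwa [show A - B - C + B = A - C by abel] at this
  refine ⟨A - C, ⟨isWeightSplitting_of_graded hW hl hu hgr, ⟨⟨hF, hW0⟩, hopp⟩, ?_⟩, ?_⟩
  · rintro p q v ⟨⟨hvF, hvW⟩, hvFb⟩
    rw [← sub_eq_zero]
    have key : ∀ m : ℤ, 1 ≤ m → (A - C) v - ((p + q : ℤ) : ℂ) • v ∈ W (p + q - m) := by
      intro m hm
      induction m, hm using Int.leInduction with
      | base => exact hgr _ v hvW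
      | succ m hm ih =>
        rw [← sub_sub]
        refine hMHS.apply_mem_of_mem_oppositePart hm hopp hvW hvFb
          (y := -(((p + q : ℤ) : ℂ) • v)) ?_ ?_ ih (by simp)
        · exact Submodule.neg_mem _ (Submodule.smul_mem _ _ (hMHS.2.2.1 (by omega) hvFb))
        · exact Submodule.sub_mem _ (by simpa using hF p v hvF) (Submodule.smul_mem _ _ hvF)
    have := hW (show p + q - max 1 (p + q - l) ≤ l by omega) (key _ (le_max_left _ _))
    rwa [hl, Submodule.mem_bot] at this
  · rintro H hH ⟨⟨hHF, hHW⟩, hHopp⟩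
    rw [← sub_eq_zero]
    refine hMHS.eq_zero_of_mem_oppositePart (Submodule.sub_mem _ hHF hF) (fun n v hv ↦ ?_)
      (Submodule.sub_mem _ hHopp hopp)
    have := Submodule.sub_mem _ (hH.apply_sub_smul_mem hHW n v hv) (hgr n v hv)
    rwa [sub_sub_sub_cancel_right] at this
end

section
/- Let (W_•, F^•, F̄^•) be a mixed Hodge structure on a finite-dimensional complex vector space V. Then V = F⁰ ⊕ Σ_{n∈ℤ} (F̄^{n+1} ∩ W_n), i.e., the subspace Σ_{n∈ℤ} (F̄^{n+1} ∩ W_n) is a vector-space complement of F⁰ in V. Moreover, in terms of the Deligne subspaces, Σ_{n∈ℤ} (F̄^{n+1} ∩ W_n) = ⊕_{i≤−1, j∈ℤ} I^{i,j}. -/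
/-- Deligne's subspace
`I^{i,j} = F^i ∩ W_{i+j} ∩ (F̄^j ∩ W_{i+j} + Σ_{k≥1} (F̄^{j−k} ∩ W_{i+j−k−1}))`. -/
def deligneI {V : Type*} [AddCommGroup V] [Module ℂ V]
    (W F Fb : ℤ → Submodule ℂ V) (i j : ℤ) : Submodule ℂ V :=
  F i ⊓ W (i + j) ⊓
    ((Fb j ⊓ W (i + j)) ⊔ ⨆ k : ℕ, Fb (j - (k : ℤ) - 1) ⊓ W (i + j - (k : ℤ) - 2))

namespace IsMHS

variable {V : Type*} [AddCommGroup V] [Module ℂ V] {W F Fb : ℤ → Submodule ℂ V}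

theorem grPiece_mono (W : ℤ → Submodule ℂ V) (n : ℤ) : Monotone (grPiece W n) :=
  fun _ _ h => Submodule.map_mono (inf_le_inf_right _ h)

/-- Induction along the weight filtration: a subspace `A` contains every `W n` as soon as
`W n ≤ A` follows from `W (n - 1) ≤ A`. -/
theorem weight_le_of_step (h : IsMHS W F Fb) {A : Submodule ℂ V} (b : ℤ)
    (step : ∀ n ≤ b, W (n - 1) ≤ A → W n ≤ A) : ∀ n ≤ b, W n ≤ A := by
  obtain ⟨hW, -, -, ⟨a, ha⟩, -, -⟩ := h
  intro n
  rcases le_total n a with hna | han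
  · intro _
    exact (hW hna).trans (ha.trans_le bot_le)
  · induction n, han using Int.leInduction with
    | base =>
      intro _
      exact ha.trans_le bot_le
    | succ n _ ih =>
      intro hn
      refine step _ hn ?_
      rw [add_sub_cancel_right]
      exact ih (by lia)

/-- `F^p` and `F̄^{n-p+1}` span `gr_n`. -/
theorem weight_le_sup (h : IsMHS W F Fb) (p n : ℤ) :
    W n ≤ W (n - 1) ⊔ ((F p ⊓ W n) ⊔ (Fb (n - p + 1) ⊓ W n)) := by
  obtain ⟨-, hF, hFb, -, -, hgr⟩ := h
  rw [← Submodule.comap_map_mkQ, ← Submodule.map_le_iff_le_comap, (hgr n).1, Submodule.map_sup]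
  refine iSup_le fun r => ?_
  rcases le_or_gt p r with hr | hr
  · exact inf_le_left.trans ((grPiece_mono W n (hF hr)).trans le_sup_left)
  · exact inf_le_right.trans ((grPiece_mono W n (hFb (by lia))).trans le_sup_right)

/-- `F^p` and `F̄^{n-p+1}` meet trivially in `gr_n`. -/
theorem mem_weight_sub_one (h : IsMHS W F Fb) {p n : ℤ} {x y : V} (hx : x ∈ F p ⊓ W n)
    (hy : y ∈ Fb (n - p + 1) ⊓ W n) (hxy : x - y ∈ W (n - 1)) : x ∈ W (n - 1) := by
  obtain ⟨-, hF, hFb, -, -, hgr⟩ := h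
  have hFx : (W (n - 1)).mkQ x ∈ grPiece W n (F p) := Submodule.mem_map_of_mem hx
  have hFbx : (W (n - 1)).mkQ x ∈ grPiece W n (Fb (n - p + 1)) := by
    rw [show (W (n - 1)).mkQ x = (W (n - 1)).mkQ y from (Submodule.Quotient.eq _).2 hxy]
    exact Submodule.mem_map_of_mem hy
  have hdisj := (hgr n).2.pairwiseDisjoint (show p ≠ p - 1 by lia)
  have h0 : (W (n - 1)).mkQ x = 0 := Submodule.disjoint_def.1 hdisj _
    ⟨hFx, grPiece_mono W n (hFb (by lia)) hFbx⟩
    ⟨grPiece_mono W n (hF (by lia)) hFx, grPiece_mono W n (hFb (by lia)) hFbx⟩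
  exact (Submodule.Quotient.mk_eq_zero _).1 h0

/-- The second factor in the definition of `I^{i,j}` surjects onto `W_{i+j-1} / F^i ∩ W_{i+j-1}`. -/
theorem weight_le_sup_deligne (h : IsMHS W F Fb) (i j : ℤ) :
    W (i + j - 1) ≤ (F i ⊓ W (i + j - 1)) ⊔
      ((Fb j ⊓ W (i + j)) ⊔ ⨆ k : ℕ, Fb (j - (k : ℤ) - 1) ⊓ W (i + j - (k : ℤ) - 2)) := by
  refine h.weight_le_of_step (i + j - 1) (fun n hn ih => ?_) _ le_rfl
  refine (h.weight_le_sup i n).trans (sup_le ih (sup_le ?_ ?_))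
  · exact (inf_le_inf_left _ (h.1 hn)).trans le_sup_left
  · refine le_sup_of_le_right ?_
    rcases hn.eq_or_lt with rfl | hlt
    · exact (inf_le_inf (h.2.2.1 (by lia)) (h.1 (by lia))).trans le_sup_left
    · refine le_sup_of_le_right (le_iSup_of_le (i + j - 2 - n).toNat ?_)
      exact inf_le_inf (h.2.2.1 (by lia)) (h.1 (by lia))

/-- `I^{p,n-p}` surjects onto the Hodge component `F^p ∩ F̄^{n-p}` of `gr_n`. -/
theorem grPiece_inf_le_map_deligneI (h : IsMHS W F Fb) (p n : ℤ) :
    grPiece W n (F p) ⊓ grPiece W n (Fb (n - p)) ≤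
      (deligneI W F Fb p (n - p)).map (W (n - 1)).mkQ := by
  obtain ⟨q, rfl⟩ : ∃ q, n = p + q := ⟨n - p, by lia⟩
  rw [add_sub_cancel_left]
  rintro _ ⟨⟨f, hf, rfl⟩, ⟨g, hg, hgf⟩⟩
  have hfg : f - g ∈ W (p + q - 1) := (Submodule.Quotient.eq _).1 hgf.symm
  obtain ⟨a, ha, u, hu, hau⟩ := Submodule.mem_sup.1 (h.weight_le_sup_deligne p q hfg)
  refine ⟨f - a, ⟨⟨sub_mem hf.1 ha.1, sub_mem hf.2 (h.1 (by lia) ha.2)⟩, ?_⟩, ?_⟩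
  · rw [show f - a = g + u by rw [sub_eq_iff_eq_add, add_assoc, add_comm u a, hau]; abel]
    exact add_mem (Submodule.mem_sup_left hg) hu
  · refine (Submodule.Quotient.eq _).2 ?_
    rw [sub_sub_cancel_left]
    exact neg_mem ha.2

/-- The Deligne subspaces span `V`. -/
theorem iSup_deligneI_eq_top (h : IsMHS W F Fb) :
    ⨆ i : ℤ, ⨆ j : ℤ, deligneI W F Fb i j = ⊤ := by
  obtain ⟨b, hb⟩ := h.2.2.2.2.1
  rw [eq_top_iff, ← hb]
  refine h.weight_le_of_step b (fun n _ ih => ?_) _ le_rfl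
  refine le_trans ?_ (sup_le ih le_rfl)
  rw [← Submodule.comap_map_mkQ, ← Submodule.map_le_iff_le_comap, (h.2.2.2.2.2 n).1]
  exact iSup_le fun p => (h.grPiece_inf_le_map_deligneI p n).trans
    (Submodule.map_mono (le_iSup₂_of_le p (n - p) le_rfl))

/-- `F^0` meets `Σ_n (F̄^{n+1} ∩ W_n)` trivially. -/
theorem disjoint_F_zero (h : IsMHS W F Fb) :
    Disjoint (F 0) (⨆ n : ℤ, Fb (n + 1) ⊓ W n) := by
  obtain ⟨hW, -, hFb, ⟨a, ha⟩, -, -⟩ := id h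
  let S : ℤ → Submodule ℂ V := fun n => ⨆ m : ℤ, ⨆ _ : m ≤ n, Fb (m + 1) ⊓ W m
  have hmono : Monotone S := fun m n hmn => biSup_mono fun r hr => hr.trans hmn
  have le_S {m n : ℤ} (hmn : m ≤ n) : Fb (m + 1) ⊓ W m ≤ S n := le_iSup₂_of_le m hmn le_rfl
  have S_le (n : ℤ) : S n ≤ W n := iSup₂_le fun m hm => inf_le_right.trans (hW hm)
  have S_split (n : ℤ) : S n ≤ (Fb (n + 1) ⊓ W n) ⊔ S (n - 1) := iSup₂_le fun m hm => by
    rcases hm.eq_or_lt with rfl | hlt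
    · exact le_sup_left
    · exact le_sup_of_le_right (le_S (by lia))
  have S_disj (n : ℤ) (hn : a ≤ n) : Disjoint (F 0) (S n) := by
    induction n, hn using Int.leInduction with
    | base => exact disjoint_bot_right.mono_right ((S_le a).trans ha.le)
    | succ n _ ih =>
      refine Submodule.disjoint_def.2 fun x hx hxS => Submodule.disjoint_def.1 ih x hx ?_
      obtain ⟨s, hs, y, hy, rfl⟩ := Submodule.mem_sup.1 (S_split _ hxS)
      have hyW := S_le _ hy
      have hxW : s + y ∈ W (n + 1 - 1) :=
        h.mem_weight_sub_one ⟨hx, S_le _ hxS⟩ (by rwa [sub_zero]) (by rwa [add_sub_cancel_left])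
      rw [add_sub_cancel_right] at hy hyW hxW
      have hsW : s ∈ W n := (Submodule.add_mem_iff_left _ hyW).1 hxW
      exact add_mem (le_S le_rfl ⟨hFb (by lia) hs.1, hsW⟩) hy
  have hS : ⨆ n : ℤ, Fb (n + 1) ⊓ W n ≤ ⨆ n, S n := iSup_mono fun n => le_S le_rfl
  refine Submodule.disjoint_def.2 fun x hx hxS => ?_
  obtain ⟨n, hn⟩ := (Submodule.mem_iSup_of_directed S hmono.directed_le).1 (hS hxS)
  exact Submodule.disjoint_def.1 (S_disj (max a n) (le_max_left _ _)) x hx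
    (hmono (le_max_right _ _) hn)

theorem deligneI_le_iSup (h : IsMHS W F Fb) {i : ℤ} (hi : i ≤ -1) (j : ℤ) :
    deligneI W F Fb i j ≤ ⨆ n : ℤ, Fb (n + 1) ⊓ W n := by
  refine inf_le_right.trans (sup_le ?_ (iSup_le fun k => ?_))
  · exact le_iSup_of_le (i + j) (inf_le_inf_right _ (h.2.2.1 (by lia)))
  · exact le_iSup_of_le (i + j - k - 2) (inf_le_inf_right _ (h.2.2.1 (by lia)))

end IsMHS

theorem complement_of_F0
    {V : Type*} [AddCommGroup V] [Module ℂ V] [FiniteDimensional ℂ V]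
    (W F Fb : ℤ → Submodule ℂ V) (hMHS : IsMHS W F Fb) :
    -- `V = F⁰ ⊕ Σ_n (F̄^{n+1} ∩ W_n)`
    (F 0 ⊔ ⨆ n : ℤ, Fb (n + 1) ⊓ W n) = ⊤ ∧
    Disjoint (F 0) (⨆ n : ℤ, Fb (n + 1) ⊓ W n) ∧
    -- `Σ_n (F̄^{n+1} ∩ W_n) = ⊕_{i ≤ −1, j} I^{i,j}`
    (⨆ n : ℤ, Fb (n + 1) ⊓ W n) =
      (⨆ i : ℤ, ⨆ (_ : i ≤ -1), ⨆ j : ℤ, deligneI W F Fb i j) := by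
  have hT : (⨆ i : ℤ, ⨆ (_ : i ≤ -1), ⨆ j : ℤ, deligneI W F Fb i j) ≤
      ⨆ n : ℤ, Fb (n + 1) ⊓ W n :=
    iSup₂_le fun i hi => iSup_le fun j => hMHS.deligneI_le_iSup hi j
  have htop : F 0 ⊔ (⨆ i : ℤ, ⨆ (_ : i ≤ -1), ⨆ j : ℤ, deligneI W F Fb i j) = ⊤ := by
    rw [eq_top_iff, ← hMHS.iSup_deligneI_eq_top]
    refine iSup_le fun i => ?_
    rcases le_or_gt i (-1) with hi | hi
    · exact le_sup_of_le_right (le_iSup₂_of_le i hi le_rfl)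
    · exact le_sup_of_le_left (iSup_le fun j =>
        (inf_le_left.trans inf_le_left).trans (hMHS.2.1 (by lia)))
  refine ⟨top_unique (htop.ge.trans (sup_le_sup_left hT _)), hMHS.disjoint_F_zero, ?_⟩
  refine (eq_of_le_of_inf_le_of_sup_le hT (z := F 0) ?_ ?_).symm
  · rw [inf_comm, hMHS.disjoint_F_zero.eq_bot]
    exact bot_le
  · rw [sup_comm _ (F 0), sup_comm _ (F 0), htop]
    exact le_top
end
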